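/- (Learnable channel selection.) Let (X, μ) be a probability space, let 0 ≤ ℓ₀ ≤ L be integers, let N₀,…,N_L ≥ 1 be group sizes with M := Σ_{ℓ=0}^L N_ℓ, and let Y_{ℓ,j} : X → ℝ (0 ≤ ℓ ≤ L, 1 ≤ j ≤ N_ℓ) be an orthonormal system in L²(μ) satisfying Σ_{j=1}^{N_ℓ} Y_{ℓ,j}(x)² = N_ℓ for every x ∈ X and every ℓ. Let β_{ℓ,j} (0 ≤ ℓ ≤ ℓ₀, 1 ≤ j ≤ N_ℓ) be real coefficients with Σ_{ℓ=0}^{ℓ₀} Σ_{j=1}^{N_ℓ} N_ℓ β_{ℓ,j}² ≤ γ₀² and satisfying the minimum-magnitude condition |β_{ℓ,j}| ≥ β₀ · N_ℓ^{−1/2} for all ℓ, j, where β₀, γ₀ > 0. Define the target f*(x) := Σ_{ℓ=0}^{ℓ₀} Σ_{j=1}^{N_ℓ} β_{ℓ,j} Y_{ℓ,j}(x). Let x₁,…,xₙ be i.i.d. samples from μ, let w₁,…,wₙ be independent mean-zero σ₀²-sub-Gaussian random variables independent of the x_i, set y_i := f*(x_i) + w_i, and let q₁,…,q_m be i.i.d.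 samples from μ independent of everything else. Define the sample matrices Y(S,ℓ) ∈ ℝ^{n×N_ℓ} with entries Y_{ℓ,j}(x_i), Y(S) ∈ ℝ^{n×M} with entries Y_{ℓ',j'}(x_i) over all (ℓ',j'), and analogously Y(Q,ℓ) ∈ ℝ^{m×N_ℓ} and Y(Q) ∈ ℝ^{m×M} with entries evaluated at q_r. Define the channel attention weights τ_ℓ := (1/(n² m)) · yᵀ Y(S,ℓ) Y(Q,ℓ)ᵀ Y(Q) Y(S)ᵀ y for 0 ≤ ℓ ≤ L, where y = (y₁,…,yₙ)ᵀ. Let ε₀ ∈ (0, β₀²/3]. Suppose m ≥ max{256 γ₀⁴/ε₀², 4} · M · log(12M/δ) and n ≥ max{ max{400 γ₀⁴/ε₀², 4} · M · log(12M/δ), 16 M (σ₀² + 1)/ε₀ }. Then there is a constant c > 0 depending only on σ₀ such that for every δ ∈ (0,1), with probability at least 1 − exp(−cM) − δ: τ_ℓ ≥ 2ε₀ for every 0 ≤ ℓ ≤ ℓ₀, and |τ_ℓ| ≤ ε₀ for every ℓ₀ < ℓ ≤ L. -/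

import Mathlib

open MeasureTheory Matrix

theorem lintegral_pi_ofReal_prod {ι : Type*} [Fintype ι] {E : ι → Type*}
    [∀ i, MeasurableSpace (E i)] (ρ : (i : ι) → Measure (E i)) [∀ i, SigmaFinite (ρ i)]
    (f : (i : ι) → E i → ℝ) (hf : ∀ i, Integrable (f i) (ρ i)) (hf0 : ∀ i x, 0 ≤ f i x) :
    ∫⁻ x, ENNReal.ofReal (∏ i, f i (x i)) ∂(Measure.pi ρ) =
      ENNReal.ofReal (∏ i, ∫ x, f i x ∂(ρ i)) := by
  rw [← ofReal_integral_eq_lintegral_ofReal (Integrable.fintype_prod_dep hf)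
    (Filter.Eventually.of_forall fun x => Finset.prod_nonneg fun i _ => hf0 i _),
    integral_fintype_prod_eq_prod]

theorem lintegral_pi_exp_sum_mul {ι : Type*} [Fintype ι] (ρ : ι → Measure ℝ)
    [∀ i, IsProbabilityMeasure (ρ i)] (l : ι → ℝ)
    (hl : ∀ i, Integrable (fun s => Real.exp (l i * s)) (ρ i)) :
    ∫⁻ w, ENNReal.ofReal (Real.exp (∑ i, l i * w i)) ∂(Measure.pi ρ) =
      ENNReal.ofReal (∏ i, ∫ s, Real.exp (l i * s) ∂(ρ i)) := by
  rw [← lintegral_pi_ofReal_prod ρ (fun i s => Real.exp (l i * s)) hl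
    fun _ _ => (Real.exp_pos _).le]
  simp_rw [Real.exp_sum]

theorem integral_exp_mul_gaussianReal_std (c : ℝ) :
    ∫ x, Real.exp (c * x) ∂(ProbabilityTheory.gaussianReal 0 1) = Real.exp (c ^ 2 / 2) := by
  have := congrFun (ProbabilityTheory.mgf_id_gaussianReal (μ := 0) (v := 1)) c
  simpa [ProbabilityTheory.mgf] using this

theorem gaussianReal_std_pdf_mul (s x : ℝ) :
    ProbabilityTheory.gaussianPDFReal 0 1 x * Real.exp (s * x ^ 2) =
      (√(2 * Real.pi))⁻¹ * Real.exp (-(1 / 2 - s) * x ^ 2) := by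
  simp only [ProbabilityTheory.gaussianPDFReal, NNReal.coe_one, mul_one, sub_zero]
  rw [mul_assoc, ← Real.exp_add]
  congr 2
  ring

theorem integrable_exp_sq_gaussianReal {s : ℝ} (hs : s < 1 / 2) :
    Integrable (fun x => Real.exp (s * x ^ 2)) (ProbabilityTheory.gaussianReal 0 1) := by
  rw [ProbabilityTheory.gaussianReal_of_var_ne_zero _ one_ne_zero,
    integrable_withDensity_iff_integrable_smul' (f := ProbabilityTheory.gaussianPDF 0 1)
      (ProbabilityTheory.measurable_gaussianPDF 0 1)
      (Filter.Eventually.of_forall fun _ => ENNReal.ofReal_lt_top)]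
  simp only [ProbabilityTheory.toReal_gaussianPDF, smul_eq_mul, gaussianReal_std_pdf_mul]
  exact (integrable_exp_neg_mul_sq (by linarith)).const_mul _

theorem integral_exp_sq_gaussianReal_le {s : ℝ} (hs0 : 0 ≤ s) (hs : s ≤ 1 / 4) :
    ∫ x, Real.exp (s * x ^ 2) ∂(ProbabilityTheory.gaussianReal 0 1) ≤
      Real.exp (s + 2 * s ^ 2) := by
  rw [ProbabilityTheory.integral_gaussianReal_eq_integral_smul one_ne_zero]
  simp only [smul_eq_mul, gaussianReal_std_pdf_mul]
  rw [integral_const_mul, integral_gaussian, ← Real.sqrt_inv, ← Real.sqrt_mul (by positivity)]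
  have h1 : (2 * Real.pi)⁻¹ * (Real.pi / (1 / 2 - s)) = (1 - 2 * s)⁻¹ := by
    have : (1 / 2 - s) ≠ 0 := by linarith
    have : (1 - 2 * s) ≠ 0 := by linarith
    have := Real.pi_ne_zero
    field_simp
  rw [h1]
  apply Real.sqrt_le_iff.2 ⟨(Real.exp_pos _).le, ?_⟩
  rw [← Real.exp_nat_mul]
  push_cast
  rw [inv_le_comm₀ (by linarith) (Real.exp_pos _), ← Real.exp_neg]
  have h2 : Real.exp (-(2 * (s + 2 * s ^ 2))) * Real.exp (2 * (s + 2 * s ^ 2)) = 1 := by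
    rw [← Real.exp_add]; simp
  have h3 : 1 + 2 * (s + 2 * s ^ 2) + (2 * (s + 2 * s ^ 2)) ^ 2 / 2
      ≤ Real.exp (2 * (s + 2 * s ^ 2)) := Real.quadratic_le_exp_of_nonneg (by positivity)
  have h4 : 1 ≤ (1 - 2 * s) * (1 + 2 * (s + 2 * s ^ 2) + (2 * (s + 2 * s ^ 2)) ^ 2 / 2) := by
    nlinarith [pow_nonneg hs0 2, pow_nonneg hs0 3, pow_nonneg hs0 4, pow_nonneg hs0 5,
      mul_nonneg (pow_nonneg hs0 2) (sub_nonneg.2 hs),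
      mul_nonneg (pow_nonneg hs0 3) (sub_nonneg.2 hs), mul_nonneg (pow_nonneg hs0 4) (sub_nonneg.2 hs)]
  have h5 : 1 ≤ (1 - 2 * s) * Real.exp (2 * (s + 2 * s ^ 2)) :=
    h4.trans (mul_le_mul_of_nonneg_left h3 (by linarith))
  have := Real.exp_pos (-(2 * (s + 2 * s ^ 2)))
  nlinarith

/-- Moment generating function of a quadratic form `∑ₖ ⟨bₖ, w⟩²` in independent sub-Gaussian
variables, for an orthogonal family `b`. -/
theorem lintegral_exp_sum_sq_le {ι κ : Type*} [Fintype ι] [Fintype κ] [DecidableEq κ]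
    (ν : ι → Measure ℝ) [∀ i, IsProbabilityMeasure (ν i)] (σ : ℝ)
    (hν : ∀ (i : ι) (l : ℝ), Integrable (fun s => Real.exp (l * s)) (ν i) ∧
      ∫ s, Real.exp (l * s) ∂(ν i) ≤ Real.exp (l ^ 2 * σ ^ 2 / 2))
    (b : κ → ι → ℝ) (e : κ → ℝ) (hb : ∀ k l, ∑ i, b k i * b l i = if k = l then e k else 0)
    {t : ℝ} (ht : 0 ≤ t) (hte : ∀ k, t * σ ^ 2 * e k ≤ 1 / 4) :
    ∫⁻ w, ENNReal.ofReal (Real.exp (t * ∑ k, (∑ i, b k i * w i) ^ 2)) ∂(Measure.pi ν) ≤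
      ENNReal.ofReal (Real.exp (∑ k, (t * σ ^ 2 * e k + 2 * (t * σ ^ 2 * e k) ^ 2))) := by
  set γ : κ → Measure ℝ := fun _ => ProbabilityTheory.gaussianReal 0 1 with hγ
  have he : ∀ k, 0 ≤ e k := fun k => by
    have := hb k k
    rw [if_pos rfl] at this
    rw [← this]
    exact Finset.sum_nonneg fun i _ => mul_self_nonneg _
  have h1 : ∀ w : ι → ℝ, ENNReal.ofReal (Real.exp (t * ∑ k, (∑ i, b k i * w i) ^ 2)) =
      ∫⁻ g, ENNReal.ofReal (Real.exp (∑ k, (√(2 * t) * ∑ i, b k i * w i) * g k))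
        ∂(Measure.pi γ) := by
    intro w
    rw [lintegral_pi_exp_sum_mul _ _ fun k => ProbabilityTheory.integrable_exp_mul_gaussianReal _]
    simp only [integral_exp_mul_gaussianReal_std]
    rw [← Real.exp_sum, Finset.mul_sum]
    congr 3 with k
    rw [mul_pow, Real.sq_sqrt (by positivity)]
    ring
  simp_rw [h1]
  rw [lintegral_lintegral_swap (Measurable.aemeasurable (by fun_prop))]
  have h2 : ∀ g : κ → ℝ, ∫⁻ w, ENNReal.ofReal
        (Real.exp (∑ k, (√(2 * t) * ∑ i, b k i * w i) * g k)) ∂(Measure.pi ν) ≤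
      ENNReal.ofReal (∏ k, Real.exp (t * σ ^ 2 * e k * g k ^ 2)) := by
    intro g
    set l : ι → ℝ := fun i => √(2 * t) * ∑ k, g k * b k i with hl
    have h3 : ∀ w : ι → ℝ, ∑ k, (√(2 * t) * ∑ i, b k i * w i) * g k = ∑ i, l i * w i := by
      intro w
      simp only [hl, Finset.mul_sum, Finset.sum_mul]
      rw [Finset.sum_comm]
      refine Finset.sum_congr rfl fun i _ => Finset.sum_congr rfl fun k _ => ?_
      ring
    simp_rw [h3]
    rw [lintegral_pi_exp_sum_mul _ _ fun i => (hν i _).1]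
    apply ENNReal.ofReal_le_ofReal
    refine (Finset.prod_le_prod (fun i _ => integral_nonneg fun s => (Real.exp_pos _).le)
      fun i _ => (hν i (l i)).2).trans ?_
    rw [← Real.exp_sum, ← Real.exp_sum]
    apply Real.exp_le_exp.2
    have h4 : ∑ i, (∑ k, g k * b k i) ^ 2 = ∑ k, e k * g k ^ 2 := by
      calc ∑ i, (∑ k, g k * b k i) ^ 2
          = ∑ i, ∑ k, ∑ j, g k * g j * (b k i * b j i) := by
            refine Finset.sum_congr rfl fun i _ => ?_
            rw [sq, Finset.sum_mul_sum]
            refine Finset.sum_congr rfl fun k _ => Finset.sum_congr rfl fun j _ => ?_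
            ring
        _ = ∑ k, ∑ j, g k * g j * ∑ i, b k i * b j i := by
            rw [Finset.sum_comm]
            refine Finset.sum_congr rfl fun k _ => ?_
            rw [Finset.sum_comm]
            refine Finset.sum_congr rfl fun j _ => ?_
            rw [Finset.mul_sum]
        _ = _ := by
            simp only [hb, mul_ite, mul_zero, Finset.sum_ite_eq, Finset.mem_univ, if_true]
            refine Finset.sum_congr rfl fun k _ => ?_
            ring
    have h5 : ∀ i, l i ^ 2 * σ ^ 2 / 2 = t * σ ^ 2 * (∑ k, g k * b k i) ^ 2 := by
      intro i
      rw [hl, mul_pow, Real.sq_sqrt (by positivity)]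
      ring
    simp_rw [h5]
    rw [← Finset.mul_sum, h4, Finset.mul_sum]
    apply le_of_eq
    refine Finset.sum_congr rfl fun k _ => ?_
    ring
  refine (lintegral_mono h2).trans ?_
  rw [lintegral_pi_ofReal_prod γ (fun k x => Real.exp (t * σ ^ 2 * e k * x ^ 2))
    (fun k => integrable_exp_sq_gaussianReal (by linarith [hte k])) fun _ _ => (Real.exp_pos _).le,
    Real.exp_sum]
  refine ENNReal.ofReal_le_ofReal (Finset.prod_le_prod
    (fun i _ => integral_nonneg fun s => (Real.exp_pos _).le) fun k _ =>
      integral_exp_sq_gaussianReal_le (mul_nonneg (by positivity) (he k)) (hte k))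

theorem exists_orthogonal_diagonalization {ι : Type*} [Fintype ι] [DecidableEq ι]
    {A : Matrix ι ι ℝ} (hA : A.IsSymm) :
    ∃ (U : Matrix ι ι ℝ) (e : ι → ℝ), U * Uᵀ = 1 ∧ Uᵀ * U = 1 ∧ A = U * diagonal e * Uᵀ := by
  have h : A.IsHermitian := by rw [Matrix.IsHermitian, conjTranspose_eq_transpose_of_trivial, hA]
  refine ⟨h.eigenvectorUnitary, h.eigenvalues, ?_, ?_, ?_⟩
  · have := (Matrix.mem_unitaryGroup_iff (A := (h.eigenvectorUnitary : Matrix ι ι ℝ))).1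
      h.eigenvectorUnitary.2
    rwa [star_eq_conjTranspose, conjTranspose_eq_transpose_of_trivial] at this
  · have := (Matrix.mem_unitaryGroup_iff' (A := (h.eigenvectorUnitary : Matrix ι ι ℝ))).1
      h.eigenvectorUnitary.2
    rwa [star_eq_conjTranspose, conjTranspose_eq_transpose_of_trivial] at this
  · have := h.spectral_theorem
    rw [Unitary.conjStarAlgAut_apply, star_eq_conjTranspose,
      conjTranspose_eq_transpose_of_trivial] at this
    exact this

theorem pow_conj_diagonal {ι : Type*} [Fintype ι] [DecidableEq ι] {U : Matrix ι ι ℝ}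
    (hU : Uᵀ * U = 1) (e : ι → ℝ) (k : ℕ) (hU' : U * Uᵀ = 1) :
    (U * diagonal e * Uᵀ) ^ k = U * diagonal (fun i => e i ^ k) * Uᵀ := by
  induction k with
  | zero => simp [hU']
  | succ k ih =>
    rw [pow_succ, ih]
    calc U * diagonal (fun i => e i ^ k) * Uᵀ * (U * diagonal e * Uᵀ)
        = U * diagonal (fun i => e i ^ k) * (Uᵀ * U) * diagonal e * Uᵀ := by
          simp only [Matrix.mul_assoc]
      _ = _ := by
          rw [hU, Matrix.mul_one, Matrix.mul_assoc U, diagonal_mul_diagonal]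
          simp only [pow_succ]

theorem trace_conj_diagonal {ι : Type*} [Fintype ι] [DecidableEq ι] {U : Matrix ι ι ℝ}
    (hU : Uᵀ * U = 1) (e : ι → ℝ) : (U * diagonal e * Uᵀ).trace = ∑ i, e i := by
  rw [trace_mul_comm, ← Matrix.mul_assoc, hU, Matrix.one_mul, trace_diagonal]

/-- The (unnormalized) Gram matrix `∑ᵢ zᵢ zᵢᵀ`. -/
noncomputable def gramSum {ι α : Type*} [Fintype α] (Z : α → ι → ℝ) : Matrix ι ι ℝ :=
  ∑ i, vecMulVec (Z i) (Z i)

theorem gramSum_apply {ι α : Type*} [Fintype α] (Z : α → ι → ℝ) (p q : ι) :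
    gramSum Z p q = ∑ i, Z i p * Z i q := by
  simp [gramSum, Matrix.sum_apply, vecMulVec_apply]

theorem gramSum_isSymm {ι α : Type*} [Fintype α] (Z : α → ι → ℝ) : (gramSum Z).IsSymm := by
  ext p q
  simp only [transpose_apply, gramSum_apply, mul_comm]

theorem measure_noise_ge_le {ι α : Type*} [Fintype ι] [DecidableEq ι] [Fintype α] [Nonempty α]
    (ν : α → Measure ℝ) [∀ i, IsProbabilityMeasure (ν i)] {σ : ℝ} (hσ : 0 < σ)
    (hν : ∀ (i : α) (l : ℝ), Integrable (fun s => Real.exp (l * s)) (ν i) ∧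
      ∫ s, Real.exp (l * s) ∂(ν i) ≤ Real.exp (l ^ 2 * σ ^ 2 / 2))
    (Z : α → ι → ℝ) (M : ℝ) (hZ : ∀ i, ∑ p, Z i p ^ 2 = M) {K : ℝ} (hK : 0 < K)
    {k : ℕ} (hk : k ≠ 0) (htr : (gramSum Z ^ k).trace ≤ (K * Fintype.card α) ^ k) :
    Measure.pi ν {w | (σ ^ 2 + 1) * M * Fintype.card α ≤ ∑ p, (∑ i, Z i p * w i) ^ 2} ≤
      ENNReal.ofReal (Real.exp (-(1 / (8 * K * (σ ^ 2 + σ ^ 4)) * M))) := by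
  obtain ⟨U, e, hU', hU, hA⟩ := exists_orthogonal_diagonalization (gramSum_isSymm Z)
  set n : ℝ := (Fintype.card α : ℝ) with hn
  have hn0 : 0 < n := by rw [hn]; exact_mod_cast Fintype.card_pos
  have hM0 : 0 ≤ M := by
    rw [← hZ (Classical.arbitrary α)]
    exact Finset.sum_nonneg fun _ _ => sq_nonneg _
  set b : ι → α → ℝ := fun k i => ∑ p, U p k * Z i p with hb
  have hbb : ∀ k l, ∑ i, b k i * b l i = if k = l then e k else 0 := by
    intro k l
    have h1 : Uᵀ * gramSum Z * U = diagonal e := by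
      rw [hA]
      calc Uᵀ * (U * diagonal e * Uᵀ) * U = (Uᵀ * U) * diagonal e * (Uᵀ * U) := by
            simp only [Matrix.mul_assoc]
        _ = _ := by rw [hU, Matrix.one_mul, Matrix.mul_one]
    have h2 : (Uᵀ * gramSum Z * U) k l = ∑ i, b k i * b l i := by
      simp only [Matrix.mul_apply, gramSum_apply, transpose_apply, hb, Finset.sum_mul_sum]
      simp only [Finset.mul_sum, Finset.sum_mul]
      rw [Finset.sum_comm]
      conv_rhs => rw [Finset.sum_comm]
      refine Finset.sum_congr rfl fun p _ => ?_
      rw [Finset.sum_comm]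
      refine Finset.sum_congr rfl fun i _ => Finset.sum_congr rfl fun q _ => ?_
      ring
    rw [← h2, h1, diagonal_apply]
  have he0 : ∀ k, 0 ≤ e k := fun k => by
    have := hbb k k
    rw [if_pos rfl] at this
    rw [← this]
    exact Finset.sum_nonneg fun i _ => mul_self_nonneg _
  have hesum : ∑ k, e k = n * M := by
    rw [← trace_conj_diagonal hU e, ← hA]
    simp only [Matrix.trace, diag_apply, gramSum_apply, ← sq]
    rw [Finset.sum_comm]
    simp [hZ, hn]
  have heK : ∀ j, e j ≤ K * n := by
    intro j
    have h1 : ∑ i, e i ^ k ≤ (K * n) ^ k := by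
      rwa [← trace_conj_diagonal hU, ← pow_conj_diagonal hU e k hU', ← hA]
    have h2 : e j ^ k ≤ (K * n) ^ k :=
      (Finset.single_le_sum (f := fun i => e i ^ k) (fun i _ => pow_nonneg (he0 i) k)
        (Finset.mem_univ j)).trans h1
    exact (pow_le_pow_iff_left₀ (he0 j) (by positivity) hk).1 h2
  have hu : ∀ w : α → ℝ, ∑ k, (∑ i, b k i * w i) ^ 2 = ∑ p, (∑ i, Z i p * w i) ^ 2 := by
    intro w
    have h1 : ∀ k, ∑ i, b k i * w i = (Uᵀ *ᵥ fun p => ∑ i, Z i p * w i) k := by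
      intro k
      simp only [hb, Matrix.mulVec, dotProduct, transpose_apply, Finset.mul_sum, Finset.sum_mul]
      rw [Finset.sum_comm]
      refine Finset.sum_congr rfl fun i _ => Finset.sum_congr rfl fun q _ => ?_
      ring
    simp_rw [h1]
    set u : ι → ℝ := fun p => ∑ i, Z i p * w i
    have h2 : (Uᵀ *ᵥ u) ⬝ᵥ (Uᵀ *ᵥ u) = u ⬝ᵥ u := by
      rw [dotProduct_mulVec, vecMul_transpose, mulVec_mulVec, hU', one_mulVec]
    simpa [dotProduct, ← sq] using h2
  set lam : ℝ := 1 / (4 * K * (σ ^ 2 + σ ^ 4)) with hlam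
  have hlam0 : 0 < lam := by positivity
  have hl1 : lam * (σ ^ 2 + σ ^ 4) * K = 1 / 4 := by
    rw [hlam]; field_simp
  have hσ2 : 0 < σ ^ 2 := by positivity
  have hσ4 : 0 < σ ^ 4 := by positivity
  have hte : ∀ k, lam / n * σ ^ 2 * e k ≤ 1 / 4 := by
    intro k
    calc lam / n * σ ^ 2 * e k ≤ lam / n * σ ^ 2 * (K * n) :=
          mul_le_mul_of_nonneg_left (heK k) (by positivity)
      _ = lam * σ ^ 2 * K := by field_simp
      _ ≤ _ := by
        have : 0 ≤ lam * σ ^ 4 * K := by positivity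
        linarith
  have hmgf := lintegral_exp_sum_sq_le ν σ hν b e hbb (t := lam / n) (by positivity) hte
  simp_rw [hu] at hmgf
  have hexp : ∑ k, (lam / n * σ ^ 2 * e k + 2 * (lam / n * σ ^ 2 * e k) ^ 2) ≤
      lam * σ ^ 2 * M + 2 * (lam ^ 2 * σ ^ 4 * K) * M := by
    calc ∑ k, (lam / n * σ ^ 2 * e k + 2 * (lam / n * σ ^ 2 * e k) ^ 2)
        ≤ ∑ k, (lam / n * σ ^ 2 + 2 * (lam / n * σ ^ 2) ^ 2 * (K * n)) * e k := by
          refine Finset.sum_le_sum fun k _ => ?_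
          have := mul_le_mul_of_nonneg_left (heK k)
            (mul_nonneg (by positivity : 0 ≤ 2 * (lam / n * σ ^ 2) ^ 2) (he0 k))
          nlinarith
      _ = _ := by
          rw [← Finset.mul_sum, hesum]
          field_simp
  set S : Set (α → ℝ) := {w | (σ ^ 2 + 1) * M * n ≤ ∑ p, (∑ i, Z i p * w i) ^ 2}
  set T : ℝ := Real.exp (lam * (σ ^ 2 + 1) * M) with hT
  have hmarkov := mul_meas_ge_le_lintegral (μ := Measure.pi ν)
    (f := fun w : α → ℝ => ENNReal.ofReal (Real.exp (lam / n * ∑ p, (∑ i, Z i p * w i) ^ 2)))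
    (by fun_prop) (ENNReal.ofReal T)
  have hsub : S ⊆ {w | ENNReal.ofReal T ≤
      ENNReal.ofReal (Real.exp (lam / n * ∑ p, (∑ i, Z i p * w i) ^ 2))} := by
    intro w hw
    apply ENNReal.ofReal_le_ofReal
    apply Real.exp_le_exp.2
    calc lam * (σ ^ 2 + 1) * M = lam / n * ((σ ^ 2 + 1) * M * n) := by field_simp
      _ ≤ _ := mul_le_mul_of_nonneg_left hw (by positivity)
  have hT0 : 0 < T := Real.exp_pos _
  have h1 : ENNReal.ofReal T * Measure.pi ν S ≤
      ENNReal.ofReal (Real.exp (lam * σ ^ 2 * M + 2 * (lam ^ 2 * σ ^ 4 * K) * M)) :=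
    ((mul_le_mul_right (measure_mono hsub) _).trans hmarkov).trans
      (hmgf.trans (ENNReal.ofReal_le_ofReal (Real.exp_le_exp.2 hexp)))
  rw [mul_comm, ← ENNReal.le_div_iff_mul_le (by simp [hT0]) (by simp),
    ← ENNReal.ofReal_div_of_pos hT0, hT, ← Real.exp_sub] at h1
  refine h1.trans (ENNReal.ofReal_le_ofReal (Real.exp_le_exp.2 ?_))
  have h8 : 1 / (8 * K * (σ ^ 2 + σ ^ 4)) = lam / 2 := by
    rw [hlam]; field_simp; norm_num
  rw [h8]
  have h9 : lam * σ ^ 4 * K ≤ 1 / 4 := by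
    have : 0 ≤ lam * σ ^ 2 * K := by positivity
    linarith
  have := mul_le_mul_of_nonneg_left h9 (mul_nonneg hlam0.le hM0)
  nlinarith

theorem chebyshev_sum_mul_sum_le {ι : Type*} [Fintype ι] (w f g : ι → ℝ) (hw : ∀ i, 0 ≤ w i)
    (hfg : ∀ i j, 0 ≤ (f i - f j) * (g i - g j)) :
    (∑ i, w i * f i) * (∑ i, w i * g i) ≤ (∑ i, w i) * ∑ i, w i * (f i * g i) := by
  have h : 0 ≤ ∑ i, ∑ j, w i * w j * ((f i - f j) * (g i - g j)) :=
    Finset.sum_nonneg fun i _ => Finset.sum_nonneg fun j _ =>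
      mul_nonneg (mul_nonneg (hw i) (hw j)) (hfg i j)
  have h1 : ∑ i, ∑ j, w i * w j * ((f i - f j) * (g i - g j)) =
      (∑ i, w i * (f i * g i)) * (∑ j, w j) + (∑ i, w i) * (∑ j, w j * (f j * g j))
      - (∑ i, w i * f i) * (∑ j, w j * g j) - (∑ i, w i * g i) * (∑ j, w j * f j) := by
    simp only [Finset.sum_mul_sum, ← Finset.sum_add_distrib, ← Finset.sum_sub_distrib]
    refine Finset.sum_congr rfl fun i _ => Finset.sum_congr rfl fun j _ => ?_
    ring
  rw [h1] at h
  linarith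

theorem dotProduct_conj_diagonal_mulVec {ι : Type*} [Fintype ι] [DecidableEq ι]
    (U : Matrix ι ι ℝ) (e y : ι → ℝ) :
    y ⬝ᵥ ((U * diagonal e * Uᵀ) *ᵥ y) = ∑ i, (Uᵀ *ᵥ y) i ^ 2 * e i := by
  rw [← mulVec_mulVec, ← mulVec_mulVec, dotProduct_mulVec, ← mulVec_transpose]
  simp only [dotProduct, mulVec_diagonal]
  refine Finset.sum_congr rfl fun i _ => ?_
  ring

theorem exists_orthogonal_diagonalization_of_posSemidef {ι : Type*} [Fintype ι] [DecidableEq ι]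
    {A : Matrix ι ι ℝ} (hA : A.PosSemidef) :
    ∃ (U : Matrix ι ι ℝ) (e : ι → ℝ), U * Uᵀ = 1 ∧ Uᵀ * U = 1 ∧ A = U * diagonal e * Uᵀ ∧
      ∀ i, 0 ≤ e i := by
  have hs : A.IsSymm := by
    have := hA.isHermitian
    rwa [Matrix.IsHermitian, conjTranspose_eq_transpose_of_trivial] at this
  obtain ⟨U, e, h1, h2, h3⟩ := exists_orthogonal_diagonalization hs
  refine ⟨U, e, h1, h2, h3, fun i => ?_⟩
  have h4 : Uᵀ * A * U = diagonal e := by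
    rw [h3]
    calc Uᵀ * (U * diagonal e * Uᵀ) * U = (Uᵀ * U) * diagonal e * (Uᵀ * U) := by
          simp only [Matrix.mul_assoc]
      _ = _ := by rw [h2, Matrix.one_mul, Matrix.mul_one]
  have h5 := (hA.conjTranspose_mul_mul_same U).diag_nonneg (i := i)
  rw [conjTranspose_eq_transpose_of_trivial, h4] at h5
  simpa using h5

theorem quad_pow_mul_quad_pow_le {ι : Type*} [Fintype ι] [DecidableEq ι]
    {A : Matrix ι ι ℝ} (hA : A.PosSemidef) (y : ι → ℝ) {M : ℝ} (hM : 0 ≤ M)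
    (hy : ∑ p, y p ^ 2 = M) (i j : ℕ) :
    (y ⬝ᵥ (A ^ i *ᵥ y)) * (y ⬝ᵥ ((A + M • 1) ^ j *ᵥ y)) ≤
      M * (y ⬝ᵥ ((A ^ i * (A + M • 1) ^ j) *ᵥ y)) := by
  obtain ⟨U, e, hU', hU, hAe, he⟩ := exists_orthogonal_diagonalization_of_posSemidef hA
  have h1 : A + M • 1 = U * diagonal (fun i => e i + M) * Uᵀ := by
    have : diagonal (fun i => e i + M) = diagonal e + M • (1 : Matrix ι ι ℝ) := by
      rw [smul_one_eq_diagonal, diagonal_add]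
    rw [this, Matrix.mul_add, Matrix.add_mul, ← hAe, Matrix.mul_smul, Matrix.mul_one,
      Matrix.smul_mul, hU']
  have h2 : A ^ i * (A + M • 1) ^ j =
      U * diagonal (fun k => e k ^ i * (e k + M) ^ j) * Uᵀ := by
    rw [h1, hAe, pow_conj_diagonal hU _ _ hU', pow_conj_diagonal hU _ _ hU']
    calc U * diagonal (fun k => e k ^ i) * Uᵀ * (U * diagonal (fun k => (e k + M) ^ j) * Uᵀ)
        = U * diagonal (fun k => e k ^ i) * (Uᵀ * U) * diagonal (fun k => (e k + M) ^ j) * Uᵀ := by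
          simp only [Matrix.mul_assoc]
      _ = _ := by
          rw [hU, Matrix.mul_one, Matrix.mul_assoc U, diagonal_mul_diagonal]
  have h3 : ∑ k, (Uᵀ *ᵥ y) k ^ 2 = M := by
    have : (Uᵀ *ᵥ y) ⬝ᵥ (Uᵀ *ᵥ y) = y ⬝ᵥ y := by
      rw [dotProduct_mulVec, vecMul_transpose, mulVec_mulVec, hU', one_mulVec]
    rw [← hy]
    simpa [dotProduct, ← sq] using this
  rw [h2, h1]
  conv_lhs => rw [hAe]
  rw [pow_conj_diagonal hU _ _ hU', pow_conj_diagonal hU _ _ hU',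
    dotProduct_conj_diagonal_mulVec, dotProduct_conj_diagonal_mulVec,
    dotProduct_conj_diagonal_mulVec, ← h3]
  refine chebyshev_sum_mul_sum_le _ _ _ (fun _ => sq_nonneg _) fun a b => ?_
  rw [h3]
  rcases le_total (e a) (e b) with hab | hab
  · exact mul_nonneg_of_nonpos_of_nonpos
      (sub_nonpos.2 (pow_le_pow_left₀ (he a) hab i))
      (sub_nonpos.2 (pow_le_pow_left₀ (add_nonneg (he a) hM) (by linarith) j))
  · exact mul_nonneg
      (sub_nonneg.2 (pow_le_pow_left₀ (he b) hab i))
      (sub_nonneg.2 (pow_le_pow_left₀ (add_nonneg (he b) hM) (by linarith) j))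

theorem dotProduct_vecMulVec_add {ι : Type*} [Fintype ι] [DecidableEq ι]
    (P Q : Matrix ι ι ℝ) (y : ι → ℝ) :
    y ⬝ᵥ ((P * vecMulVec y y * Q) *ᵥ y) = (y ⬝ᵥ (P *ᵥ y)) * (y ⬝ᵥ (Q *ᵥ y)) := by
  rw [← mulVec_mulVec, ← mulVec_mulVec, vecMulVec_mulVec, mulVec_smul, dotProduct_smul]
  simp

theorem quad_pow_mul_add_pow_le {ι : Type*} [Fintype ι] [DecidableEq ι]
    {A : Matrix ι ι ℝ} (hA : A.PosSemidef) (y : ι → ℝ) {M : ℝ} (hM : 0 ≤ M)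
    (hy : ∑ p, y p ^ 2 = M) (j i : ℕ) :
    y ⬝ᵥ ((A ^ i * (A + vecMulVec y y) ^ j) *ᵥ y) ≤
      y ⬝ᵥ ((A ^ i * (A + M • 1) ^ j) *ᵥ y) := by
  induction j generalizing i with
  | zero => simp
  | succ j ih =>
    have h1 : A ^ i * (A + vecMulVec y y) ^ (j + 1) =
        A ^ (i + 1) * (A + vecMulVec y y) ^ j +
          A ^ i * vecMulVec y y * (A + vecMulVec y y) ^ j := by
      rw [pow_succ', pow_succ]
      noncomm_ring
    have h2 : A ^ i * (A + M • 1) ^ (j + 1) =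
        A ^ (i + 1) * (A + M • 1) ^ j + M • (A ^ i * (A + M • 1) ^ j) := by
      rw [pow_succ', pow_succ, Matrix.add_mul, Matrix.mul_add, Matrix.smul_mul, Matrix.one_mul,
        Matrix.mul_smul, Matrix.mul_assoc]
    have h3 := ih 0
    simp only [pow_zero, Matrix.one_mul] at h3
    have h4 : 0 ≤ y ⬝ᵥ (A ^ i *ᵥ y) := by
      simpa using (hA.pow i).dotProduct_mulVec_nonneg y
    rw [h1, h2, add_mulVec, add_mulVec, dotProduct_add, dotProduct_add,
      dotProduct_vecMulVec_add, smul_mulVec, dotProduct_smul, smul_eq_mul]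
    exact add_le_add (ih (i + 1)) ((mul_le_mul_of_nonneg_left h3 h4).trans
      (quad_pow_mul_quad_pow_le hA y hM hy i j))

theorem trace_pow_mul_add_pow_le {ι : Type*} [Fintype ι] [DecidableEq ι]
    {A : Matrix ι ι ℝ} (hA : A.PosSemidef) (y : ι → ℝ) {M : ℝ} (hM : 0 ≤ M)
    (hy : ∑ p, y p ^ 2 = M) (k i : ℕ) :
    M * ((A ^ i * (A + vecMulVec y y) ^ k).trace - (A ^ (i + k)).trace) ≤
      y ⬝ᵥ ((A ^ i * (A + M • 1) ^ k) *ᵥ y) - y ⬝ᵥ (A ^ (i + k) *ᵥ y) := by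
  induction k generalizing i with
  | zero => simp
  | succ k ih =>
    have h1 : A ^ i * (A + vecMulVec y y) ^ (k + 1) =
        A ^ (i + 1) * (A + vecMulVec y y) ^ k +
          A ^ i * vecMulVec y y * (A + vecMulVec y y) ^ k := by
      rw [pow_succ', pow_succ]
      noncomm_ring
    have h2 : A ^ i * (A + M • 1) ^ (k + 1) =
        A ^ (i + 1) * (A + M • 1) ^ k + M • (A ^ i * (A + M • 1) ^ k) := by
      rw [pow_succ', pow_succ, Matrix.add_mul, Matrix.mul_add, Matrix.smul_mul, Matrix.one_mul,
        Matrix.mul_smul, Matrix.mul_assoc]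
    have hAs : Aᵀ = A := by
      have := hA.isHermitian
      rwa [Matrix.IsHermitian, conjTranspose_eq_transpose_of_trivial] at this
    have h3 : (A ^ i * vecMulVec y y * (A + vecMulVec y y) ^ k).trace =
        y ⬝ᵥ ((A ^ i * (A + vecMulVec y y) ^ k) *ᵥ y) := by
      rw [mul_vecMulVec, vecMulVec_mul, trace_vecMulVec, ← mulVec_transpose, dotProduct_comm,
        dotProduct_mulVec, ← mulVec_transpose, dotProduct_comm, transpose_pow, transpose_pow,
        transpose_add, transpose_vecMulVec, hAs, mulVec_mulVec]
    have h4 := ih (i + 1)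
    have h5 := mul_le_mul_of_nonneg_left (quad_pow_mul_add_pow_le hA y hM hy k i) hM
    have h6 : i + (k + 1) = i + 1 + k := by ring
    rw [h1, h2, trace_add, h3, h6, add_mulVec, dotProduct_add, smul_mulVec, dotProduct_smul,
      smul_eq_mul]
    linarith

theorem trace_add_vecMulVec_pow_le {ι : Type*} [Fintype ι] [DecidableEq ι]
    {A : Matrix ι ι ℝ} (hA : A.PosSemidef) (y : ι → ℝ) {M : ℝ} (hM : 0 < M)
    (hy : ∑ p, y p ^ 2 = M) (k : ℕ) :
    ((A + vecMulVec y y) ^ k).trace ≤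
      (A ^ k).trace + M⁻¹ * (y ⬝ᵥ (((A + M • 1) ^ k - A ^ k) *ᵥ y)) := by
  have h := trace_pow_mul_add_pow_le hA y hM.le hy k 0
  simp only [pow_zero, Matrix.one_mul, zero_add] at h
  rw [sub_mulVec, dotProduct_sub, ← sub_le_iff_le_add', le_inv_mul_iff₀ hM]
  exact h

theorem gramSum_add_smul_one_posSemidef {ι α : Type*} [Fintype ι] [DecidableEq ι] [Fintype α]
    (Z : α → ι → ℝ) {s : ℝ} (hs : 0 ≤ s) : (gramSum Z + s • (1 : Matrix ι ι ℝ)).PosSemidef := by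
  refine PosSemidef.add ?_ (PosSemidef.one.smul hs)
  refine posSemidef_sum _ fun i _ => ?_
  simpa using posSemidef_vecMulVec_self_star (Z i)

theorem exists_bound_and_measurable_pow {Ω ι : Type*} [MeasurableSpace Ω] [Fintype ι]
    [DecidableEq ι] {G : Ω → Matrix ι ι ℝ} (hG : ∀ p q, Measurable fun x => G x p q) {B : ℝ}
    (hB : ∀ x p q, |G x p q| ≤ B) (k : ℕ) :
    (∀ p q, Measurable fun x => (G x ^ k) p q) ∧ ∃ C, ∀ x p q, |(G x ^ k) p q| ≤ C := by
  induction k with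
  | zero =>
    refine ⟨fun p q => by simp, 1, fun x p q => ?_⟩
    rw [pow_zero, one_apply]
    split_ifs <;> simp
  | succ k ih =>
    obtain ⟨h1, C, hC⟩ := ih
    simp only [pow_succ, Matrix.mul_apply]
    refine ⟨fun p q => Finset.measurable_fun_sum _ fun r _ => (h1 p r).mul (hG r q),
      ∑ _ : ι, C * B, fun x p q => ?_⟩
    refine (Finset.abs_sum_le_sum_abs _ _).trans (Finset.sum_le_sum fun r _ => ?_)
    rw [abs_mul]
    exact mul_le_mul (hC x p r) (hB x r q) (abs_nonneg _) ((abs_nonneg _).trans (hC x p r))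

theorem integrable_trace_pow {Ω ι : Type*} [MeasurableSpace Ω] [Fintype ι]
    [DecidableEq ι] (P : Measure Ω) [IsFiniteMeasure P]
    {G : Ω → Matrix ι ι ℝ} (hG : ∀ p q, Measurable fun x => G x p q) {B : ℝ}
    (hB : ∀ x p q, |G x p q| ≤ B) (k : ℕ) : Integrable (fun x => (G x ^ k).trace) P := by
  obtain ⟨h1, C, hC⟩ := exists_bound_and_measurable_pow hG hB k
  simp only [Matrix.trace, diag_apply]
  refine integrable_finsetSum _ fun p _ => ?_
  exact Integrable.of_bound (h1 p p).aestronglyMeasurable C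
    (Filter.Eventually.of_forall fun x => hC x p p)

theorem abs_le_of_sum_sq_eq {ι : Type*} [Fintype ι] {y : ι → ℝ} {M : ℝ}
    (hy : ∑ p, y p ^ 2 = M) (p : ι) : |y p| ≤ √M := by
  apply Real.abs_le_sqrt
  rw [← hy]
  exact Finset.single_le_sum (f := fun p => y p ^ 2) (fun _ _ => sq_nonneg _) (Finset.mem_univ p)

theorem abs_gramSum_add_le {ι α : Type*} [Fintype ι] [DecidableEq ι] [Fintype α]
    {Z : α → ι → ℝ} {M s : ℝ} (hM : 0 ≤ M) (hs : 0 ≤ s) (hZ : ∀ i, ∑ p, Z i p ^ 2 = M) (p q : ι) :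
    |(gramSum Z + s • (1 : Matrix ι ι ℝ)) p q| ≤ Fintype.card α * M + s := by
  rw [Matrix.add_apply, gramSum_apply, Matrix.smul_apply, Matrix.one_apply, smul_eq_mul]
  refine (abs_add_le _ _).trans (add_le_add ?_ ?_)
  · refine (Finset.abs_sum_le_sum_abs _ _).trans ?_
    refine (Finset.sum_le_sum (g := fun _ => M) fun i _ => ?_).trans (by simp)
    rw [abs_mul, ← Real.mul_self_sqrt hM]
    exact mul_le_mul (abs_le_of_sum_sq_eq (hZ i) p) (abs_le_of_sum_sq_eq (hZ i) q)
      (abs_nonneg _) (Real.sqrt_nonneg _)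
  · split_ifs <;> simp [abs_of_nonneg hs, hs]

section Moments

variable {X : Type*} [MeasurableSpace X] (μ : Measure X) [IsProbabilityMeasure μ]
  {ι : Type*} [Fintype ι] {y : X → ι → ℝ}

theorem integrable_mul_of_sum_sq_eq (hm : ∀ p, Measurable fun x => y x p) {M : ℝ}
    (hy : ∀ x, ∑ p, y x p ^ 2 = M) (p q : ι) : Integrable (fun x => y x p * y x q) μ := by
  refine Integrable.of_bound ((hm p).mul (hm q)).aestronglyMeasurable (√M * √M)
    (Filter.Eventually.of_forall fun x => ?_)
  rw [Real.norm_eq_abs, abs_mul]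
  exact mul_le_mul (abs_le_of_sum_sq_eq (hy x) p) (abs_le_of_sum_sq_eq (hy x) q)
      (abs_nonneg _) (Real.sqrt_nonneg _)

theorem quad_eq_sum (P : Matrix ι ι ℝ) (v : ι → ℝ) :
    v ⬝ᵥ (P *ᵥ v) = ∑ p, ∑ q, P p q * (v p * v q) := by
  simp only [dotProduct, mulVec, Finset.mul_sum]
  refine Finset.sum_congr rfl fun p _ => Finset.sum_congr rfl fun q _ => ?_
  ring

theorem integrable_quad (hm : ∀ p, Measurable fun x => y x p) {M : ℝ}
    (hy : ∀ x, ∑ p, y x p ^ 2 = M) (P : Matrix ι ι ℝ) :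
    Integrable (fun x => y x ⬝ᵥ (P *ᵥ y x)) μ := by
  simp only [quad_eq_sum]
  exact integrable_finsetSum _ fun p _ => integrable_finsetSum _ fun q _ =>
    (integrable_mul_of_sum_sq_eq μ hm hy p q).const_mul _

theorem integral_quad [DecidableEq ι] (hm : ∀ p, Measurable fun x => y x p) {M : ℝ}
    (hy : ∀ x, ∑ p, y x p ^ 2 = M)
    (hort : ∀ p q, ∫ x, y x p * y x q ∂μ = if p = q then 1 else 0) (P : Matrix ι ι ℝ) :
    ∫ x, y x ⬝ᵥ (P *ᵥ y x) ∂μ = P.trace := by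
  simp only [quad_eq_sum]
  have hi : ∀ p q, Integrable (fun x => P p q * (y x p * y x q)) μ := fun p q =>
    (integrable_mul_of_sum_sq_eq μ hm hy p q).const_mul _
  rw [integral_finsetSum _ fun p _ => integrable_finsetSum _ fun q _ => hi p q]
  simp only [Matrix.trace, diag_apply]
  refine Finset.sum_congr rfl fun p _ => ?_
  rw [integral_finsetSum _ fun q _ => hi p q]
  simp [integral_const_mul, hort]

theorem integral_trace_add_vecMulVec_pow_le [DecidableEq ι]
    (hm : ∀ p, Measurable fun x => y x p) {M : ℝ} (hM : 0 < M) (hy : ∀ x, ∑ p, y x p ^ 2 = M)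
    (hort : ∀ p q, ∫ x, y x p * y x q ∂μ = if p = q then 1 else 0)
    {A : Matrix ι ι ℝ} (hA : A.PosSemidef) (k : ℕ) :
    ∫ x, ((A + vecMulVec (y x) (y x)) ^ k).trace ∂μ ≤
      (1 - M⁻¹) * (A ^ k).trace + M⁻¹ * ((A + M • 1) ^ k).trace := by
  have hi := ((integrable_quad μ hm hy ((A + M • 1) ^ k - A ^ k)).const_mul M⁻¹)
  have h1 := integral_mono_of_nonneg (μ := μ)
    (f := fun x => ((A + vecMulVec (y x) (y x)) ^ k).trace)
    (Filter.Eventually.of_forall fun x => by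
      refine ((hA.add ?_).pow k).trace_nonneg
      simpa using posSemidef_vecMulVec_self_star (y x))
    ((integrable_const (A ^ k).trace).add hi)
    (Filter.Eventually.of_forall fun x => trace_add_vecMulVec_pow_le hA (y x) hM (hy x) k)
  refine h1.trans (le_of_eq ?_)
  simp only [Pi.add_apply]
  rw [integral_add (integrable_const _) hi, integral_const_mul, integral_quad μ hm hy hort,
    trace_sub]
  simp
  ring

theorem integral_trace_gramSum_pow_le [DecidableEq ι] (hm : ∀ p, Measurable fun x => y x p)
    (hM : 0 < Fintype.card ι) (hy : ∀ x, ∑ p, y x p ^ 2 = (Fintype.card ι : ℝ))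
    (hort : ∀ p q, ∫ x, y x p * y x q ∂μ = if p = q then 1 else 0) (k n : ℕ) (s : ℝ)
    (hs : 0 ≤ s) :
    ∫ x, ((gramSum (fun i => y (x i)) + s • 1) ^ k).trace ∂(Measure.pi fun _ : Fin n => μ) ≤
      Fintype.card ι * (k.factorial * (Fintype.card ι : ℝ) ^ k) *
        Real.exp (s / Fintype.card ι) *
        (1 + (Real.exp 1 - 1) / Fintype.card ι) ^ n := by
  set M : ℝ := (Fintype.card ι : ℝ) with hMdef
  have hM0 : 0 < M := by rw [hMdef]; exact_mod_cast hM
  have hM1 : 1 ≤ M := by rw [hMdef]; exact_mod_cast hM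
  induction n generalizing s with
  | zero =>
    have h1 : ∀ x : Fin 0 → X, ((gramSum (fun i => y (x i)) + s • (1 : Matrix ι ι ℝ)) ^ k).trace =
        M * s ^ k := by
      intro x
      have : gramSum (fun i => y (x i)) = 0 := by simp [gramSum]
      rw [this, zero_add, smul_pow, one_pow, trace_smul, trace_one, smul_eq_mul, mul_comm]
    simp only [h1, integral_const, probReal_univ, one_smul, pow_zero, mul_one]
    rw [mul_assoc]
    refine mul_le_mul_of_nonneg_left ?_ hM0.le
    have h2 := Real.pow_div_factorial_le_exp (s / M) (by positivity) k
    rw [div_le_iff₀ (by positivity), div_pow, div_le_iff₀ (by positivity)] at h2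
    linarith
  | succ n ih =>
    set ρ : ℝ := 1 + (Real.exp 1 - 1) / M with hρ
    have hmeas : ∀ p q, Measurable fun x : Fin (n + 1) → X =>
        (gramSum (fun i => y (x i)) + s • (1 : Matrix ι ι ℝ)) p q := by
      intro p q
      simp only [Matrix.add_apply, gramSum_apply]
      exact (Finset.measurable_fun_sum _ fun i _ =>
        ((hm p).comp (measurable_pi_apply i)).mul ((hm q).comp (measurable_pi_apply i))).add_const _
    have h_integ : Integrable (fun x : Fin (n + 1) → X =>
        ((gramSum (fun i => y (x i)) + s • (1 : Matrix ι ι ℝ)) ^ k).trace)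
        (Measure.pi fun _ : Fin (n + 1) => μ) :=
      integrable_trace_pow _ hmeas (fun x p q => abs_gramSum_add_le hM0.le hs (fun i => hy _) p q) k
    have hmp := (measurePreserving_piFinSuccAbove (fun _ : Fin (n + 1) => μ) 0).symm
    rw [← hmp.integral_comp']
    have h_integ2 := hmp.integrable_comp_of_integrable h_integ
    simp only [Function.comp_def] at h_integ2
    rw [integral_prod_symm _ h_integ2]
    have hmeas' : ∀ s' : ℝ, ∀ p q, Measurable fun x : Fin n → X =>
        (gramSum (fun i => y (x i)) + s' • (1 : Matrix ι ι ℝ)) p q := by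
      intro s' p q
      simp only [Matrix.add_apply, gramSum_apply]
      exact (Finset.measurable_fun_sum _ fun i _ =>
        ((hm p).comp (measurable_pi_apply i)).mul ((hm q).comp (measurable_pi_apply i))).add_const _
    have h_integ' : ∀ s' : ℝ, 0 ≤ s' → Integrable (fun x : Fin n → X =>
        ((gramSum (fun i => y (x i)) + s' • (1 : Matrix ι ι ℝ)) ^ k).trace)
        (Measure.pi fun _ : Fin n => μ) := fun s' hs' =>
      integrable_trace_pow _ (hmeas' s')
        (fun x p q => abs_gramSum_add_le hM0.le hs' (fun i => hy _) p q) k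
    have hstep : ∀ x : Fin n → X, ∀ x0 : X,
        gramSum (fun i => y ((MeasurableEquiv.piFinSuccAbove (fun _ : Fin (n + 1) => X) 0).symm
          (x0, x) i)) + s • (1 : Matrix ι ι ℝ) =
        (gramSum (fun i => y (x i)) + s • 1) + vecMulVec (y x0) (y x0) := by
      intro x x0
      simp only [gramSum, MeasurableEquiv.piFinSuccAbove_symm_apply, Fin.insertNthEquiv,
        Fin.sum_univ_succ, Fin.insertNth_zero, Equiv.coe_fn_mk, Fin.cons_succ, Fin.cons_zero,
        Fin.zero_succAbove, cast_eq]
      abel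
    have hle : ∀ x : Fin n → X,
        ∫ x0, ((gramSum (fun i => y ((MeasurableEquiv.piFinSuccAbove
          (fun _ : Fin (n + 1) => X) 0).symm (x0, x) i)) + s • (1 : Matrix ι ι ℝ)) ^ k).trace ∂μ ≤
        (1 - M⁻¹) * ((gramSum (fun i => y (x i)) + s • (1 : Matrix ι ι ℝ)) ^ k).trace +
          M⁻¹ * ((gramSum (fun i => y (x i)) + (s + M) • (1 : Matrix ι ι ℝ)) ^ k).trace := by
      intro x
      simp only [hstep]
      rw [add_smul, ← add_assoc]
      exact integral_trace_add_vecMulVec_pow_le μ hm hM0 hy hort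
        (gramSum_add_smul_one_posSemidef _ hs) k
    have hiA := (h_integ' s hs).const_mul (1 - M⁻¹)
    have hiB := (h_integ' (s + M) (by positivity)).const_mul M⁻¹
    refine (integral_mono h_integ2.integral_prod_right (hiA.add hiB) hle).trans ?_
    simp only [Pi.add_apply]
    rw [integral_add hiA hiB, integral_const_mul, integral_const_mul]
    have h1 := mul_le_mul_of_nonneg_left (ih s hs) (sub_nonneg.2 (inv_le_one_of_one_le₀ hM1))
    have h2 := mul_le_mul_of_nonneg_left (ih (s + M) (by positivity)) (inv_nonneg.2 hM0.le)
    refine (add_le_add h1 h2).trans (le_of_eq ?_)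
    have h3 : Real.exp ((s + M) / M) = Real.exp (s / M) * Real.exp 1 := by
      rw [← Real.exp_add, add_div, div_self hM0.ne']
    have h6 : ρ ^ n * ρ = ρ ^ n * (1 + (Real.exp 1 - 1) * M⁻¹) := by rw [hρ, div_eq_mul_inv]
    rw [h3, pow_succ, h6]
    ring

theorem measure_trace_gramSum_pow_gt_le [DecidableEq ι] (hm : ∀ p, Measurable fun x => y x p)
    (hM : 0 < Fintype.card ι) (hy : ∀ x, ∑ p, y x p ^ 2 = (Fintype.card ι : ℝ))
    (hort : ∀ p q, ∫ x, y x p * y x q ∂μ = if p = q then 1 else 0) (n : ℕ)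
    (hn : 8 * (Fintype.card ι : ℝ) ≤ n) :
    ∃ k : ℕ, k ≠ 0 ∧ (Measure.pi fun _ : Fin n => μ)
      {x | (Real.exp 5 * n) ^ k ≤ (gramSum (fun i => y (x i)) ^ k).trace} ≤
      ENNReal.ofReal (Fintype.card ι * Real.exp (-(2 * (n / Fintype.card ι)))) := by
  set M : ℝ := (Fintype.card ι : ℝ) with hMdef
  have hM0 : 0 < M := by rw [hMdef]; exact_mod_cast hM
  set r : ℝ := n / M with hr
  have hr8 : 8 ≤ r := by rw [hr, le_div_iff₀ hM0]; exact hn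
  have hn0 : 0 < (n : ℝ) := by linarith
  set k : ℕ := ⌊r⌋₊ with hk
  have hk1 : (k : ℝ) ≤ r := Nat.floor_le (by linarith)
  have hk2 : r < k + 1 := Nat.lt_floor_add_one r
  have hk0 : k ≠ 0 := by
    rintro h
    rw [h] at hk2
    norm_num at hk2
    linarith
  refine ⟨k, hk0, ?_⟩
  have hE := integral_trace_gramSum_pow_le μ hm hM hy hort k n 0 le_rfl
  simp only [zero_smul, add_zero, zero_div, Real.exp_zero, mul_one] at hE
  rw [← hMdef] at hE
  have hmeas : ∀ p q, Measurable fun x : Fin n → X => gramSum (fun i => y (x i)) p q := by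
    intro p q
    simp only [gramSum_apply]
    exact Finset.measurable_fun_sum _ fun i _ =>
      ((hm p).comp (measurable_pi_apply i)).mul ((hm q).comp (measurable_pi_apply i))
  have h_integ : Integrable (fun x : Fin n → X => (gramSum (fun i => y (x i)) ^ k).trace)
      (Measure.pi fun _ : Fin n => μ) :=
    integrable_trace_pow _ hmeas (B := Fintype.card (Fin n) * M + 0) (fun x p q => by
      have := abs_gramSum_add_le (ι := ι) hM0.le le_rfl (fun i : Fin n => hy (x i)) p q
      simpa using this) k
  have h0 : 0 ≤ᵐ[Measure.pi fun _ : Fin n => μ]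
      fun x : Fin n → X => (gramSum (fun i => y (x i)) ^ k).trace := by
    refine Filter.Eventually.of_forall fun x => PosSemidef.trace_nonneg (PosSemidef.pow ?_ k)
    simpa using gramSum_add_smul_one_posSemidef (ι := ι) (fun i : Fin n => y (x i)) le_rfl
  have hmk := (mul_meas_ge_le_integral_of_nonneg h0 h_integ ((Real.exp 5 * n) ^ k)).trans hE
  have hpos : 0 < (Real.exp 5 * (n : ℝ)) ^ k := by positivity
  rw [← ofReal_measureReal]
  apply ENNReal.ofReal_le_ofReal
  rw [mul_comm, ← le_div_iff₀ hpos] at hmk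
  refine hmk.trans ?_
  rw [div_le_iff₀ hpos, mul_assoc M, mul_assoc M]
  refine mul_le_mul_of_nonneg_left ?_ hM0.le
  have hfac : (k.factorial : ℝ) * M ^ k ≤ (n : ℝ) ^ k := by
    have h1 : (k.factorial : ℝ) ≤ (k : ℝ) ^ k := by exact_mod_cast Nat.factorial_le_pow k
    calc (k.factorial : ℝ) * M ^ k ≤ (k : ℝ) ^ k * M ^ k := by gcongr
      _ = (k * M) ^ k := (mul_pow _ _ _).symm
      _ ≤ (n : ℝ) ^ k := by
        refine pow_le_pow_left₀ (by positivity) ?_ k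
        rwa [← le_div_iff₀ hM0]
  have he1 : 1 ≤ Real.exp 1 := Real.one_le_exp (by norm_num)
  have he2 : Real.exp 1 < 2.7182818286 := Real.exp_one_lt_d9
  have hρ : (1 + (Real.exp 1 - 1) / M) ^ n ≤ Real.exp (1.72 * r) := by
    calc (1 + (Real.exp 1 - 1) / M) ^ n ≤ Real.exp ((Real.exp 1 - 1) / M) ^ n := by
          refine pow_le_pow_left₀ ?_ ?_ n
          · have : 0 ≤ (Real.exp 1 - 1) / M := div_nonneg (by linarith) hM0.le
            linarith
          · linarith [Real.add_one_le_exp ((Real.exp 1 - 1) / M)]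
      _ = Real.exp ((Real.exp 1 - 1) * r) := by
          rw [← Real.exp_nat_mul, hr]
          congr 1
          ring
      _ ≤ _ := Real.exp_le_exp.2 (mul_le_mul_of_nonneg_right (by linarith) (by linarith))
  have hK : (Real.exp 5 * (n : ℝ)) ^ k = Real.exp (k * 5) * n ^ k := by
    rw [mul_pow, ← Real.exp_nat_mul]
  rw [hK, mul_comm (_ * _)]
  calc (1 + (Real.exp 1 - 1) / M) ^ n * (↑k.factorial * M ^ k)
      ≤ Real.exp (1.72 * r) * n ^ k := mul_le_mul hρ hfac (by positivity) (Real.exp_pos _).le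
    _ ≤ (Real.exp (-(2 * r)) * Real.exp (k * 5)) * n ^ k := by
        refine mul_le_mul_of_nonneg_right ?_ (by positivity)
        rw [← Real.exp_add]
        exact Real.exp_le_exp.2 (by linarith)
    _ = _ := by ring

end Moments

theorem exp_le_one_add_add_sq {x : ℝ} (hx : |x| ≤ 1 / 4) : Real.exp x ≤ 1 + x + 0.55 * x ^ 2 := by
  have h := (abs_le.1 (Real.exp_bound (n := 4) (hx.trans (by norm_num)) (by norm_num))).2
  simp only [Finset.sum_range_succ, Finset.sum_range_zero, Nat.factorial] at h
  obtain ⟨h1, h2⟩ := abs_le.1 hx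
  have h4 : |x| ^ 4 = x ^ 2 * x ^ 2 := by rw [show |x| ^ 4 = (|x| ^ 2) ^ 2 by ring, sq_abs]; ring
  have h5 : x ^ 2 ≤ 1 / 16 := by nlinarith
  have h6 : x ^ 3 ≤ x ^ 2 * (1 / 4) := by nlinarith [sq_nonneg x]
  have h7 : x ^ 2 * x ^ 2 ≤ x ^ 2 * (1 / 16) := mul_le_mul_of_nonneg_left h5 (sq_nonneg x)
  rw [h4] at h
  norm_num at h
  nlinarith [sq_nonneg x]

theorem integral_exp_mul_le {X : Type*} [MeasurableSpace X] (μ : Measure X) [IsProbabilityMeasure μ]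
    {g : X → ℝ} (hg : Measurable g) {R v l : ℝ} (hR : ∀ x, |g x| ≤ R) (hv : ∫ x, g x ^ 2 ∂μ ≤ v)
    (hl : |l| * R ≤ 1 / 4) :
    Integrable (fun x => Real.exp (l * g x)) μ ∧
      ∫ x, Real.exp (l * g x) ∂μ ≤ Real.exp (l * ∫ x, g x ∂μ + 0.55 * l ^ 2 * v) := by
  have hb : ∀ x, |l * g x| ≤ 1 / 4 := fun x => by
    rw [abs_mul]
    exact (mul_le_mul_of_nonneg_left (hR x) (abs_nonneg l)).trans hl
  have hi : Integrable (fun x => Real.exp (l * g x)) μ :=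
    Integrable.of_bound (hg.const_mul l).exp.aestronglyMeasurable (Real.exp (1 / 4))
      (Filter.Eventually.of_forall fun x => by
        rw [Real.norm_eq_abs, Real.abs_exp]
        exact Real.exp_le_exp.2 (le_of_abs_le (hb x)))
  have h1 : Integrable g μ := Integrable.of_bound hg.aestronglyMeasurable R
    (Filter.Eventually.of_forall hR)
  have h2 : Integrable (fun x => g x ^ 2) μ :=
    Integrable.of_bound (hg.pow_const 2).aestronglyMeasurable (R ^ 2)
      (Filter.Eventually.of_forall fun x => by
        rw [Real.norm_eq_abs, abs_pow]
        exact pow_le_pow_left₀ (abs_nonneg _) (hR x) 2)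
  have hA : Integrable (fun x => 1 + l * g x) μ := (integrable_const 1).add (h1.const_mul l)
  have hB : Integrable (fun x => 0.55 * l ^ 2 * g x ^ 2) μ := h2.const_mul _
  refine ⟨hi, (integral_mono hi (hA.add hB) (g := fun x => 1 + l * g x + 0.55 * l ^ 2 * g x ^ 2)
    fun x => (exp_le_one_add_add_sq (hb x)).trans (le_of_eq (by ring))).trans ?_⟩
  rw [integral_add hA hB, integral_add (integrable_const 1) (h1.const_mul l), integral_const_mul,
    integral_const_mul]
  have h3 := mul_le_mul_of_nonneg_left hv (show 0 ≤ 0.55 * l ^ 2 by positivity)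
  have h4 := Real.add_one_le_exp (l * ∫ x, g x ∂μ + 0.55 * l ^ 2 * v)
  simp only [integral_const, probReal_univ, one_smul]
  linarith

theorem measure_sum_ge_le {X : Type*} [MeasurableSpace X] (μ : Measure X) [IsProbabilityMeasure μ]
    {g : X → ℝ} (hg : Measurable g) {R v κ : ℝ} (hR : ∀ x, |g x| ≤ R) (hv : ∫ x, g x ^ 2 ∂μ ≤ v)
    (hv0 : 0 < v) (hκ : 0 ≤ κ) (h : 30 * R ^ 2 * κ ≤ v) (n : ℕ) :
    (Measure.pi fun _ : Fin n => μ)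
      {x | n * (∫ x, g x ∂μ) + n * √(2.2 * v * κ) ≤ ∑ i, g (x i)} ≤
      ENNReal.ofReal (Real.exp (-(n * κ))) := by
  obtain ⟨x₀⟩ : Nonempty X := nonempty_of_isProbabilityMeasure μ
  have hR0 : 0 ≤ R := (abs_nonneg _).trans (hR x₀)
  set t := √(2.2 * v * κ) with ht
  have ht2 : t ^ 2 = 2.2 * v * κ := Real.sq_sqrt (by positivity)
  have ht0 : 0 ≤ t := Real.sqrt_nonneg _
  set l := t / (1.1 * v) with hl
  have hl0 : 0 ≤ l := by positivity
  have hlR : |l| * R ≤ 1 / 4 := by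
    rw [abs_of_nonneg hl0]
    apply le_of_sq_le_sq _ (by norm_num)
    have : (l * R) ^ 2 = (2.2 * κ * R ^ 2) / (1.21 * v) := by
      rw [hl, mul_pow, div_pow, ht2]
      field_simp
      ring
    rw [this, div_le_iff₀ (by positivity)]
    nlinarith
  obtain ⟨hi, hE⟩ := integral_exp_mul_le μ hg hR hv hlR
  have h_integ : Integrable (fun x : Fin n → X => ∏ i, Real.exp (l * g (x i)))
      (Measure.pi fun _ : Fin n => μ) := Integrable.fintype_prod fun _ => hi
  have hmk := mul_meas_ge_le_integral_of_nonneg (Filter.Eventually.of_forall fun x =>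
    Finset.prod_nonneg fun i _ => (Real.exp_pos _).le) h_integ
    (Real.exp (l * (n * (∫ x, g x ∂μ) + n * t)))
  have hset : {x : Fin n → X | n * (∫ x, g x ∂μ) + n * t ≤ ∑ i, g (x i)} ⊆
      {x | Real.exp (l * (n * (∫ x, g x ∂μ) + n * t)) ≤ ∏ i, Real.exp (l * g (x i))} := by
    intro x hx
    simp only [Set.mem_ofPred_eq] at hx ⊢
    rw [← Real.exp_sum, ← Finset.mul_sum]
    exact Real.exp_le_exp.2 (mul_le_mul_of_nonneg_left hx hl0)
  refine (measure_mono hset).trans ?_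
  rw [← ofReal_measureReal]
  apply ENNReal.ofReal_le_ofReal
  rw [mul_comm, ← le_div_iff₀ (Real.exp_pos _)] at hmk
  refine hmk.trans ?_
  rw [div_le_iff₀ (Real.exp_pos _), integral_fintype_prod_eq_pow (fun x => Real.exp (l * g x)),
    Fintype.card_fin, ← Real.exp_add]
  refine (pow_le_pow_left₀ (integral_nonneg fun x => (Real.exp_pos _).le) hE n).trans ?_
  rw [← Real.exp_nat_mul]
  apply Real.exp_le_exp.2
  have hk : 0.55 * l ^ 2 * v = l * t - κ := by
    have h1 : l * t = 2 * κ := by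
      rw [hl, div_mul_eq_mul_div, ← sq, ht2]
      field_simp
      ring
    have h2 : 1.1 * v * l = t := by rw [hl]; field_simp
    have : 0.55 * l ^ 2 * v = l * t / 2 := by rw [← h2]; ring
    linarith
  rw [hk]
  apply le_of_eq
  ring

theorem measure_empirical_mean_sub_sq_gt_le {X : Type*} [MeasurableSpace X] (μ : Measure X)
    [IsProbabilityMeasure μ] {g : X → ℝ} (hg : Measurable g) {R v κ : ℝ} (hR : ∀ x, |g x| ≤ R)
    (hv : ∫ x, g x ^ 2 ∂μ ≤ v) (hκ : 0 < κ) (h : 30 * R ^ 2 * κ ≤ v) {n : ℕ} (hn : 0 < n) :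
    (Measure.pi fun _ : Fin n => μ)
      {x | 2.2 * v * κ < ((∑ i, g (x i)) / n - ∫ x, g x ∂μ) ^ 2} ≤
      ENNReal.ofReal (2 * Real.exp (-(n * κ))) := by
  have hn' : (0 : ℝ) < n := by exact_mod_cast hn
  obtain hv0 | hv0 := (show 0 ≤ v from le_trans (by positivity) h).eq_or_lt
  · have hR2 : R = 0 := by
      have h1 : R ^ 2 ≤ 0 := by
        by_contra! h2
        have : 0 < 30 * R ^ 2 * κ := by positivity
        linarith
      exact pow_eq_zero_iff two_ne_zero |>.1 (le_antisymm h1 (sq_nonneg R))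
    have hg0 : ∀ x, g x = 0 := fun x => abs_nonpos_iff.1 (hR2 ▸ hR x)
    simp [hg0, ← hv0]
  set t := √(2.2 * v * κ) with ht
  have h1 := measure_sum_ge_le μ hg hR hv hv0 hκ.le h n
  have h2 := measure_sum_ge_le μ hg.neg (fun x => (abs_neg (g x)).trans_le (hR x))
    (by simpa using hv) hv0 hκ.le h n
  simp only [Pi.neg_apply, integral_neg, Finset.sum_neg_distrib] at h2
  rw [two_mul, ENNReal.ofReal_add (Real.exp_pos _).le (Real.exp_pos _).le]
  refine (measure_mono ?_).trans ((measure_union_le _ _).trans (add_le_add h1 h2))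
  intro x hx
  simp only [Set.mem_ofPred_eq, Set.mem_union] at hx ⊢
  have h3 : t < |(∑ i, g (x i)) / n - ∫ x, g x ∂μ| := by
    rw [ht, ← Real.sqrt_sq_eq_abs]
    exact Real.sqrt_lt_sqrt (by positivity) hx
  have h4 : (∑ i, g (x i)) = n * ((∑ i, g (x i)) / n) := by field_simp
  rcases lt_abs.1 h3 with h5 | h5
  · left
    nlinarith
  · right
    nlinarith

theorem sq_sum_mul_le {ι : Type*} [Fintype ι] (a y : ι → ℝ) {M : ℝ} (hy : ∑ p, y p ^ 2 = M) :
    (∑ p, a p * y p) ^ 2 ≤ M * ∑ p, a p ^ 2 := by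
  rw [← hy, mul_comm]
  exact Finset.sum_mul_sq_le_sq_mul_sq _ _ _

theorem measurable_sum_mul {X ι : Type*} [MeasurableSpace X] [Fintype ι] {y : X → ι → ℝ}
    (hm : ∀ p, Measurable fun x => y x p) (a : ι → ℝ) :
    Measurable fun x => ∑ p, a p * y x p :=
  Finset.measurable_fun_sum _ fun p _ => (hm p).const_mul (a p)

theorem integrable_sq_sum_mul {X ι : Type*} [MeasurableSpace X] (μ : Measure X)
    [IsFiniteMeasure μ] [Fintype ι] {y : X → ι → ℝ} (hm : ∀ p, Measurable fun x => y x p) {M : ℝ}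
    (hy : ∀ x, ∑ p, y x p ^ 2 = M) (a : ι → ℝ) :
    Integrable (fun x => (∑ p, a p * y x p) ^ 2) μ := by
  refine Integrable.of_bound ((measurable_sum_mul hm a).pow_const 2).aestronglyMeasurable
    (M * ∑ p, a p ^ 2) (Filter.Eventually.of_forall fun x => ?_)
  rw [Real.norm_eq_abs, abs_of_nonneg (sq_nonneg _)]
  exact sq_sum_mul_le a (y x) (hy x)

section Deviations

variable {X : Type*} [MeasurableSpace X] (μ : Measure X) [IsProbabilityMeasure μ]
  {ι : Type*} [Fintype ι] [DecidableEq ι] {y : X → ι → ℝ}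

theorem integral_sum_mul_sum (hm : ∀ p, Measurable fun x => y x p) {M : ℝ}
    (hy : ∀ x, ∑ p, y x p ^ 2 = M)
    (hort : ∀ p q, ∫ x, y x p * y x q ∂μ = if p = q then 1 else 0) (a a' : ι → ℝ) :
    ∫ x, (∑ p, a p * y x p) * ∑ p, a' p * y x p ∂μ = ∑ p, a p * a' p := by
  have hi : ∀ p q, Integrable (fun x => a p * a' q * (y x p * y x q)) μ := fun p q =>
    (integrable_mul_of_sum_sq_eq μ hm hy p q).const_mul _
  have h1 : ∀ x, (∑ p, a p * y x p) * ∑ p, a' p * y x p =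
      ∑ p, ∑ q, a p * a' q * (y x p * y x q) := by
    intro x
    rw [Finset.sum_mul_sum]
    refine Finset.sum_congr rfl fun p _ => Finset.sum_congr rfl fun q _ => ?_
    ring
  simp only [h1]
  rw [integral_finsetSum _ fun p _ => integrable_finsetSum _ fun q _ => hi p q]
  refine Finset.sum_congr rfl fun p _ => ?_
  rw [integral_finsetSum _ fun q _ => hi p q]
  simp [integral_const_mul, hort]

theorem integral_sq_sum_mul (hm : ∀ p, Measurable fun x => y x p) {M : ℝ}
    (hy : ∀ x, ∑ p, y x p ^ 2 = M)
    (hort : ∀ p q, ∫ x, y x p * y x q ∂μ = if p = q then 1 else 0) (a : ι → ℝ) :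
    ∫ x, (∑ p, a p * y x p) ^ 2 ∂μ = ∑ p, a p ^ 2 := by
  simp only [sq, integral_sum_mul_sum μ hm hy hort]

theorem measure_bilinear_mean_sub_sq_gt_le (hm : ∀ p, Measurable fun x => y x p) {M : ℝ}
    (hy : ∀ x, ∑ p, y x p ^ 2 = M)
    (hort : ∀ p q, ∫ x, y x p * y x q ∂μ = if p = q then 1 else 0) (a a' : ι → ℝ)
    {κ : ℝ} (hκ : 0 < κ) (hκM : 30 * M * κ ≤ 1) {n : ℕ} (hn : 0 < n) :
    (Measure.pi fun _ : Fin n => μ)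
      {x | 2.2 * (M * (∑ p, a p ^ 2) * ∑ p, a' p ^ 2) * κ <
        ((∑ i, (∑ p, a p * y (x i) p) * ∑ p, a' p * y (x i) p) / n - ∑ p, a p * a' p) ^ 2} ≤
      ENNReal.ofReal (2 * Real.exp (-(n * κ))) := by
  obtain ⟨x₀⟩ : Nonempty X := nonempty_of_isProbabilityMeasure μ
  have hM : 0 ≤ M := (hy x₀) ▸ Finset.sum_nonneg fun p _ => sq_nonneg _
  set A := ∑ p, a p ^ 2 with hA
  set A' := ∑ p, a' p ^ 2 with hA'
  have hA0 : 0 ≤ A := Finset.sum_nonneg fun p _ => sq_nonneg _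
  have hA0' : 0 ≤ A' := Finset.sum_nonneg fun p _ => sq_nonneg _
  have hsq : ∀ x, ((∑ p, a p * y x p) * ∑ p, a' p * y x p) ^ 2 ≤
      M * A * (∑ p, a' p * y x p) ^ 2 := by
    intro x
    rw [mul_pow]
    exact mul_le_mul_of_nonneg_right (sq_sum_mul_le a (y x) (hy x)) (sq_nonneg _)
  have hg := (measurable_sum_mul hm a).mul (measurable_sum_mul hm a')
  have hi' := (integrable_sq_sum_mul μ hm hy a').const_mul (M * A)
  have := measure_empirical_mean_sub_sq_gt_le μ hg (R := √(M * A * (M * A'))) (v := M * A * A')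
    (fun x => Real.abs_le_sqrt ((hsq x).trans (mul_le_mul_of_nonneg_left
      (sq_sum_mul_le a' (y x) (hy x)) (by positivity)))) ?_ hκ ?_ hn
  · simp only [Pi.mul_apply, integral_sum_mul_sum μ hm hy hort] at this
    exact this
  · refine (integral_mono_of_nonneg (Filter.Eventually.of_forall fun x => sq_nonneg _) hi'
      (Filter.Eventually.of_forall fun x => hsq x)).trans (le_of_eq ?_)
    rw [integral_const_mul, integral_sq_sum_mul μ hm hy hort]
  · rw [Real.sq_sqrt (by positivity)]
    calc 30 * (M * A * (M * A')) * κ = M * A * A' * (30 * M * κ) := by ring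
      _ ≤ M * A * A' * 1 := mul_le_mul_of_nonneg_left hκM (by positivity)
      _ = _ := mul_one _

theorem measure_signal_mean_sub_sq_gt_le (hm : ∀ p, Measurable fun x => y x p)
    (hy : ∀ x, ∑ p, y x p ^ 2 = (Fintype.card ι : ℝ))
    (hort : ∀ p q, ∫ x, y x p * y x q ∂μ = if p = q then 1 else 0) (b : ι → ℝ) {F : ℝ}
    (hF : ∀ x, (∑ p, b p * y x p) ^ 2 ≤ F) {κ : ℝ} (hκ : 0 < κ)
    (hκF : 30 * F * Fintype.card ι * κ ≤ 0.01 * ∑ p, b p ^ 2) {n : ℕ} (hn : 0 < n) :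
    (Measure.pi fun _ : Fin n => μ)
      {x | 2.222 * (Fintype.card ι * ∑ p, b p ^ 2) * κ <
        ∑ p, ((∑ i, (∑ q, b q * y (x i) q) * y (x i) p) / n - b p) ^ 2} ≤
      ENNReal.ofReal (Fintype.card ι * (2 * Real.exp (-(n * κ)))) := by
  obtain ⟨x₀⟩ : Nonempty X := nonempty_of_isProbabilityMeasure μ
  have hF0 : 0 ≤ F := (sq_nonneg _).trans (hF x₀)
  set M : ℝ := (Fintype.card ι : ℝ) with hMdef
  have hM0 : 0 ≤ M := by positivity
  set B := ∑ p, b p ^ 2 with hB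
  set V : ι → ℝ := fun p => ∫ x, ((∑ q, b q * y x q) * y x p) ^ 2 ∂μ with hV
  have hi : ∀ p, Integrable (fun x => ((∑ q, b q * y x q) * y x p) ^ 2) μ := by
    intro p
    refine Integrable.of_bound
      (((measurable_sum_mul hm b).mul (hm p)).pow_const 2).aestronglyMeasurable
      (F * M) (Filter.Eventually.of_forall fun x => ?_)
    rw [Real.norm_eq_abs, abs_of_nonneg (sq_nonneg _), mul_pow]
    refine mul_le_mul (hF x) ?_ (sq_nonneg _) hF0
    rw [← hy x]
    exact Finset.single_le_sum (f := fun p => y x p ^ 2) (fun _ _ => sq_nonneg _)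
      (Finset.mem_univ p)
  have hVsum : ∑ p, V p = M * B := by
    rw [hV, ← integral_finsetSum _ fun p _ => hi p]
    simp only [mul_pow, ← Finset.mul_sum, hy]
    rw [integral_mul_const, integral_sq_sum_mul μ hm hy hort, mul_comm]
  have hV0 : ∀ p, 0 ≤ V p := fun p => integral_nonneg fun x => sq_nonneg _
  have hcoord : ∀ p, (Measure.pi fun _ : Fin n => μ)
      {x | 2.2 * (V p + 0.01 * B) * κ <
        ((∑ i, (∑ q, b q * y (x i) q) * y (x i) p) / n - b p) ^ 2} ≤
      ENNReal.ofReal (2 * Real.exp (-(n * κ))) := by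
    intro p
    have h_integ : ∫ x, (∑ q, b q * y x q) * y x p ∂μ = b p := by
      have := integral_sum_mul_sum μ hm hy hort b (Pi.single p 1)
      simpa [Pi.single_apply] using this
    have hg := (measurable_sum_mul hm b).mul (hm p)
    have := measure_empirical_mean_sub_sq_gt_le μ hg (R := √(F * M)) (v := V p + 0.01 * B)
      (fun x => Real.abs_le_sqrt ?_) ?_ hκ ?_ hn
    · simp only [Pi.mul_apply, h_integ] at this
      exact this
    · rw [Pi.mul_apply, mul_pow]
      refine mul_le_mul (hF x) ?_ (sq_nonneg _) hF0
      rw [← hy x]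
      exact Finset.single_le_sum (f := fun p => y x p ^ 2) (fun _ _ => sq_nonneg _)
        (Finset.mem_univ p)
    · have hB0 : 0 ≤ B := Finset.sum_nonneg fun p _ => sq_nonneg _
      have : V p ≤ V p + 0.01 * B := by linarith
      exact this
    · rw [Real.sq_sqrt (by positivity)]
      have := hV0 p
      linarith
  have hsub : {x : Fin n → X | 2.222 * (M * B) * κ <
        ∑ p, ((∑ i, (∑ q, b q * y (x i) q) * y (x i) p) / n - b p) ^ 2} ⊆
      ⋃ p, {x | 2.2 * (V p + 0.01 * B) * κ <
        ((∑ i, (∑ q, b q * y (x i) q) * y (x i) p) / n - b p) ^ 2} := by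
    intro x hx
    simp only [Set.mem_ofPred_eq, Set.mem_iUnion] at hx ⊢
    by_contra! hcon
    have h1 := Finset.sum_le_sum fun p (_ : p ∈ Finset.univ) => hcon p
    rw [← Finset.sum_mul, ← Finset.mul_sum, Finset.sum_add_distrib, hVsum, Finset.sum_const,
      Finset.card_univ, nsmul_eq_mul, ← hMdef] at h1
    refine absurd (hx.trans_le h1) (not_lt.2 (le_of_eq ?_))
    ring
  refine (measure_mono hsub).trans ((measure_iUnion_fintype_le _ _).trans
    ((Finset.sum_le_sum fun p _ => hcoord p).trans (le_of_eq ?_)))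
  rw [Finset.sum_const, Finset.card_univ, nsmul_eq_mul, ENNReal.ofReal_mul hM0, hMdef,
    ENNReal.ofReal_natCast]

end Deviations

theorem le_measure_prod_prod {Ω₁ Ω₂ Ω₃ : Type*} [MeasurableSpace Ω₁] [MeasurableSpace Ω₂]
    [MeasurableSpace Ω₃] (P₁ : Measure Ω₁) (P₂ : Measure Ω₂) (P₃ : Measure Ω₃)
    [IsProbabilityMeasure P₁] [IsProbabilityMeasure P₂] [IsProbabilityMeasure P₃]
    {B₁ : Set Ω₁} {B₂ : Set (Ω₁ × Ω₂)} {B₃ : Set (Ω₁ × Ω₂ × Ω₃)} (hB₁ : MeasurableSet B₁)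
    (hB₂ : MeasurableSet B₂) (hB₃ : MeasurableSet B₃) {c₁ c₂ c₃ : ℝ} (hc₁ : 0 ≤ c₁) (hc₂ : 0 ≤ c₂)
    (hc₃ : 0 ≤ c₃) (h₁ : P₁ B₁ ≤ ENNReal.ofReal c₁)
    (h₂ : ∀ x, x ∉ B₁ → P₂ {w | (x, w) ∈ B₂} ≤ ENNReal.ofReal c₂)
    (h₃ : ∀ x w, P₃ {q | (x, w, q) ∈ B₃} ≤ ENNReal.ofReal c₃) {G : Set (Ω₁ × Ω₂ × Ω₃)}
    (hG : ∀ x w q, x ∉ B₁ → (x, w) ∉ B₂ → (x, w, q) ∉ B₃ → (x, w, q) ∈ G) :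
    ENNReal.ofReal (1 - (c₁ + c₂ + c₃)) ≤ P₁.prod (P₂.prod P₃) G := by
  set P := P₁.prod (P₂.prod P₃) with hP
  set E₁ : Set (Ω₁ × Ω₂ × Ω₃) := {ω | ω.1 ∈ B₁} with hE₁
  set E₂ : Set (Ω₁ × Ω₂ × Ω₃) := {ω | ω.1 ∉ B₁ ∧ (ω.1, ω.2.1) ∈ B₂} with hE₂
  have m₁ : MeasurableSet E₁ := measurable_fst hB₁
  have m₂ : MeasurableSet E₂ := (measurable_fst hB₁.compl).inter
    ((measurable_fst.prodMk (measurable_fst.comp measurable_snd)) hB₂)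
  have p₁ : P E₁ ≤ ENNReal.ofReal c₁ := by
    have : E₁ = B₁ ×ˢ Set.univ := by ext; simp [hE₁]
    rw [this, hP, Measure.prod_prod, measure_univ, mul_one]
    exact h₁
  have p₂ : P E₂ ≤ ENNReal.ofReal c₂ := by
    rw [hP, Measure.prod_apply m₂]
    refine (lintegral_mono (g := fun _ => ENNReal.ofReal c₂) fun x => ?_).trans (by simp)
    by_cases hx : x ∈ B₁
    · simp [hE₂, hx]
    · have : Prod.mk x ⁻¹' E₂ = {w | (x, w) ∈ B₂} ×ˢ Set.univ := by ext; simp [hE₂, hx]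
      rw [this, Measure.prod_prod, measure_univ, mul_one]
      exact h₂ x hx
  have p₃ : P B₃ ≤ ENNReal.ofReal c₃ := by
    rw [hP, Measure.prod_apply hB₃]
    refine (lintegral_mono (g := fun _ => ENNReal.ofReal c₃) fun x => ?_).trans (by simp)
    rw [Measure.prod_apply (measurable_prodMk_left hB₃)]
    exact (lintegral_mono (g := fun _ => ENNReal.ofReal c₃) fun w => h₃ x w).trans (by simp)
  have hU : P (E₁ ∪ E₂ ∪ B₃) ≤ ENNReal.ofReal (c₁ + c₂ + c₃) := by
    rw [ENNReal.ofReal_add (by positivity) hc₃, ENNReal.ofReal_add hc₁ hc₂]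
    exact (measure_union_le _ _).trans
      (add_le_add ((measure_union_le _ _).trans (add_le_add p₁ p₂)) p₃)
  have hsub : (E₁ ∪ E₂ ∪ B₃)ᶜ ⊆ G := by
    rintro ⟨x, w, q⟩ h
    simp only [Set.mem_compl_iff, Set.mem_union, not_or, hE₁, hE₂, Set.mem_ofPred_eq,
      not_and] at h
    exact hG x w q h.1.1 (h.1.2 h.1.1) h.2
  refine le_trans ?_ (measure_mono hsub)
  rw [prob_compl_eq_one_sub ((m₁.union m₂).union hB₃), ENNReal.ofReal_sub _ (by positivity),
    ENNReal.ofReal_one]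
  exact tsub_le_tsub_left hU 1

theorem sqrt_sum_sq_add_le {ι : Type*} (T : Finset ι) (u v : ι → ℝ) :
    √(∑ p ∈ T, (u p + v p) ^ 2) ≤ √(∑ p ∈ T, u p ^ 2) + √(∑ p ∈ T, v p ^ 2) := by
  have h := norm_add_le (WithLp.toLp 2 fun p : T => u p) (WithLp.toLp 2 fun p : T => v p)
  simp only [EuclideanSpace.norm_eq, PiLp.add_apply, Real.norm_eq_abs, sq_abs] at h
  simpa only [Finset.sum_coe_sort T (fun p => (u p + v p) ^ 2),
    Finset.sum_coe_sort T (fun p => u p ^ 2), Finset.sum_coe_sort T (fun p => v p ^ 2)] using h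

theorem abs_sub_sq_le_of_mul_le {g c r γ s a t τ : ℝ} (hr : 0 < r) (hg : 0 < g) (hγ : g * r ≤ γ)
    (hs : s * γ ≤ 0.0746 * r ^ 2) (hs0 : 0 ≤ s) (ha : a ≤ γ + s + r / 4) (ht : 0 ≤ t)
    (hτ : |τ - t ^ 2| * γ ^ 2 ≤ 0.0928 * r ^ 2 * (t * a))
    (hc : 0.0928 * (g ^ 2 + g / 4 + 0.0746) ≤ c * g ^ 3) : |τ - t ^ 2| ≤ c * r * t := by
  have hγ0 : 0 < γ := (mul_pos hg hr).trans_le hγ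
  have hs1 : s * g ≤ 0.0746 * r := by
    have : s * (g * r) ≤ s * γ := mul_le_mul_of_nonneg_left hγ hs0
    nlinarith
  have h1 : a * g ≤ γ * g + 0.0746 * r + r / 4 * g := by nlinarith
  have h2 : g ^ 2 * (a * g * r) ≤ (g ^ 2 + g / 4 + 0.0746) * γ ^ 2 := by
    have e1 : g * r * γ ≤ γ ^ 2 := by nlinarith
    have e2 : (g * r) ^ 2 ≤ γ ^ 2 := pow_le_pow_left₀ (by positivity) hγ 2
    have e3 : g ^ 2 * (a * g * r) ≤ g ^ 2 * ((γ * g + 0.0746 * r + r / 4 * g) * r) := by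
      gcongr
    have e4 : g ^ 2 * (g * r * γ) ≤ g ^ 2 * γ ^ 2 := by gcongr
    have e5 : g * (g * r) ^ 2 ≤ g * γ ^ 2 := by gcongr
    nlinarith
  have h3 : 0.0928 * r ^ 2 * (t * a) * g ^ 3 ≤ (c * r * t * γ ^ 2) * g ^ 3 := by
    calc 0.0928 * r ^ 2 * (t * a) * g ^ 3 = 0.0928 * (r * t) * (g ^ 2 * (a * g * r)) := by ring
      _ ≤ 0.0928 * (r * t) * ((g ^ 2 + g / 4 + 0.0746) * γ ^ 2) := by gcongr
      _ = (r * t * γ ^ 2) * (0.0928 * (g ^ 2 + g / 4 + 0.0746)) := by ring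
      _ ≤ (r * t * γ ^ 2) * (c * g ^ 3) := by gcongr
      _ = _ := by ring
  have h4 := le_of_mul_le_mul_right h3 (by positivity)
  exact le_of_mul_le_mul_right (hτ.trans h4) (by positivity)

section Weights

variable {ι : Type*} [Fintype ι] {T : Finset ι} {b s e : ι → ℝ} {γ r τ : ℝ}

theorem sqrt_sum_signal_mul_le (hs : (∑ p, s p ^ 2) * γ ^ 2 ≤ 2.222 / 400 * r ^ 4) :
    √(∑ p, s p ^ 2) * γ ≤ 0.0746 * r ^ 2 := by
  apply le_of_sq_le_sq _ (by positivity)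
  rw [mul_pow, Real.sq_sqrt (Finset.sum_nonneg fun _ _ => sq_nonneg _)]
  refine hs.trans ?_
  nlinarith [show 0 ≤ r ^ 4 by positivity]

theorem sqrt_sum_noise_le (hr : 0 < r) (he : ∑ p, e p ^ 2 ≤ r ^ 2 / 16) (T : Finset ι) :
    √(∑ p ∈ T, e p ^ 2) ≤ r / 4 := by
  apply Real.sqrt_le_iff.2 ⟨by positivity, ?_⟩
  refine (Finset.sum_le_univ_sum_of_nonneg fun _ => sq_nonneg _).trans (he.trans (le_of_eq ?_))
  ring

theorem sqrt_sum_le_sqrt_sum_univ (T : Finset ι) :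
    √(∑ p ∈ T, s p ^ 2) ≤ √(∑ p, s p ^ 2) :=
  Real.sqrt_le_sqrt (Finset.sum_le_univ_sum_of_nonneg fun _ => sq_nonneg _)

theorem sqrt_sum_coef_le (hγ0 : 0 < γ) (hr : 0 < r) (hb : ∑ p, b p ^ 2 ≤ γ ^ 2)
    (he : ∑ p, e p ^ 2 ≤ r ^ 2 / 16) :
    √(∑ p, (b p + (s p + e p)) ^ 2) ≤ γ + √(∑ p, s p ^ 2) + r / 4 := by
  have h1 := sqrt_sum_sq_add_le Finset.univ b (fun p => s p + e p)
  have h2 := sqrt_sum_sq_add_le Finset.univ s e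
  have h3 : √(∑ p, b p ^ 2) ≤ γ := Real.sqrt_le_iff.2 ⟨hγ0.le, hb⟩
  have h4 := sqrt_sum_noise_le hr he Finset.univ
  linarith

theorem abs_sub_mul_sq_le {a t : ℝ} (ha : 0 ≤ a) (ht : 0 ≤ t)
    (hτ : (τ - t ^ 2) ^ 2 * γ ^ 4 ≤ 2.2 / 256 * r ^ 4 * (t ^ 2 * a ^ 2)) :
    |τ - t ^ 2| * γ ^ 2 ≤ 0.0928 * r ^ 2 * (t * a) := by
  apply le_of_sq_le_sq _ (by positivity)
  calc (|τ - t ^ 2| * γ ^ 2) ^ 2 = (τ - t ^ 2) ^ 2 * γ ^ 4 := by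
        rw [mul_pow, sq_abs]; ring
    _ ≤ 2.2 / 256 * r ^ 4 * (t ^ 2 * a ^ 2) := hτ
    _ ≤ 0.0928 ^ 2 * r ^ 4 * (t ^ 2 * a ^ 2) := by gcongr; norm_num
    _ = _ := by ring

theorem abs_weight_le_of_redundant (hγ0 : 0 < γ) (hr : 0 < r) (hγ : 3 * r ^ 2 ≤ γ ^ 2)
    (hb : ∑ p, b p ^ 2 ≤ γ ^ 2) (hs : (∑ p, s p ^ 2) * γ ^ 2 ≤ 2.222 / 400 * r ^ 4)
    (he : ∑ p, e p ^ 2 ≤ r ^ 2 / 16) (hT : ∀ p ∈ T, b p = 0)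
    (hτ : (τ - ∑ p ∈ T, (b p + (s p + e p)) ^ 2) ^ 2 * γ ^ 4 ≤ 2.2 / 256 * r ^ 4 *
      ((∑ p ∈ T, (b p + (s p + e p)) ^ 2) * ∑ p, (b p + (s p + e p)) ^ 2)) :
    |τ| ≤ r ^ 2 := by
  set t := √(∑ p ∈ T, (b p + (s p + e p)) ^ 2) with ht
  set a := √(∑ p, (b p + (s p + e p)) ^ 2) with ha
  set S := √(∑ p, s p ^ 2) with hS
  have ht2 : t ^ 2 = ∑ p ∈ T, (b p + (s p + e p)) ^ 2 :=
    Real.sq_sqrt (Finset.sum_nonneg fun _ _ => sq_nonneg _)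
  have ha2 : a ^ 2 = ∑ p, (b p + (s p + e p)) ^ 2 :=
    Real.sq_sqrt (Finset.sum_nonneg fun _ _ => sq_nonneg _)
  rw [← ht2, ← ha2] at hτ
  have ht0 : 0 ≤ t := Real.sqrt_nonneg _
  have hS0 : 0 ≤ S := Real.sqrt_nonneg _
  have hg : 1.732 * r ≤ γ := by
    apply le_of_sq_le_sq _ hγ0.le
    nlinarith [sq_nonneg r]
  have hSγ := sqrt_sum_signal_mul_le hs
  have h1 := abs_sub_sq_le_of_mul_le (c := 0.0628) hr (by norm_num) hg hSγ hS0
    (sqrt_sum_coef_le hγ0 hr hb he) ht0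
    (abs_sub_mul_sq_le (Real.sqrt_nonneg _) ht0 hτ) (by norm_num)
  have hS1 : S ≤ 0.0432 * r := by
    have : S * (1.732 * r) ≤ S * γ := mul_le_mul_of_nonneg_left hg hS0
    nlinarith
  have ht1 : t ≤ 0.2932 * r := by
    have h2 := sqrt_sum_sq_add_le T s e
    have h3 : t = √(∑ p ∈ T, (s p + e p) ^ 2) := by
      rw [ht]
      congr 1
      exact Finset.sum_congr rfl fun p hp => by rw [hT p hp, zero_add]
    have h4 := sqrt_sum_noise_le hr he T
    have h5 := sqrt_sum_le_sqrt_sum_univ (s := s) T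
    linarith
  have h6 : t ^ 2 ≤ (0.2932 * r) ^ 2 := pow_le_pow_left₀ ht0 ht1 2
  have h7 : 0.0628 * r * t ≤ 0.0628 * r * (0.2932 * r) := by gcongr
  have h8 : |τ| ≤ |τ - t ^ 2| + t ^ 2 := by
    have := abs_add_le (τ - t ^ 2) (t ^ 2)
    rwa [sub_add_cancel, abs_of_nonneg (sq_nonneg t)] at this
  nlinarith [sq_nonneg r]

theorem two_mul_le_weight_of_informative (hγ0 : 0 < γ) (hr : 0 < r)
    (hγ : 6 * r ^ 2 ≤ γ ^ 2 ∨ 3 * r ^ 2 ≤ γ ^ 2 ∧ ∀ p ∈ T, s p = 0)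
    (hb : ∑ p, b p ^ 2 ≤ γ ^ 2) (hs : (∑ p, s p ^ 2) * γ ^ 2 ≤ 2.222 / 400 * r ^ 4)
    (he : ∑ p, e p ^ 2 ≤ r ^ 2 / 16) (hT : 3 * r ^ 2 ≤ ∑ p ∈ T, b p ^ 2)
    (hτ : (τ - ∑ p ∈ T, (b p + (s p + e p)) ^ 2) ^ 2 * γ ^ 4 ≤ 2.2 / 256 * r ^ 4 *
      ((∑ p ∈ T, (b p + (s p + e p)) ^ 2) * ∑ p, (b p + (s p + e p)) ^ 2)) :
    2 * r ^ 2 ≤ τ := by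
  set t := √(∑ p ∈ T, (b p + (s p + e p)) ^ 2) with ht
  set a := √(∑ p, (b p + (s p + e p)) ^ 2) with ha
  set S := √(∑ p, s p ^ 2) with hS
  have ht2 : t ^ 2 = ∑ p ∈ T, (b p + (s p + e p)) ^ 2 :=
    Real.sq_sqrt (Finset.sum_nonneg fun _ _ => sq_nonneg _)
  have ha2 : a ^ 2 = ∑ p, (b p + (s p + e p)) ^ 2 :=
    Real.sq_sqrt (Finset.sum_nonneg fun _ _ => sq_nonneg _)
  rw [← ht2, ← ha2] at hτ
  have ht0 : 0 ≤ t := Real.sqrt_nonneg _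
  have hS0 : 0 ≤ S := Real.sqrt_nonneg _
  have hSγ := sqrt_sum_signal_mul_le hs
  have hbT : 1.732 * r ≤ √(∑ p ∈ T, b p ^ 2) := by
    apply Real.le_sqrt_of_sq_le
    nlinarith [sq_nonneg r]
  have htri : √(∑ p ∈ T, b p ^ 2) ≤ t + (√(∑ p ∈ T, s p ^ 2) + r / 4) := by
    have h1 := sqrt_sum_sq_add_le T (fun p => b p + (s p + e p)) (fun p => -(s p + e p))
    have h2 := sqrt_sum_sq_add_le T s e
    have h3 := sqrt_sum_noise_le hr he T
    simp only [add_neg_cancel_right, neg_sq] at h1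
    linarith
  have key : ∀ c d : ℝ, d * r ≤ t → |τ - t ^ 2| ≤ c * r * t → 0 ≤ c → c ≤ d →
      2 ≤ d * (d - c) → 2 * r ^ 2 ≤ τ := by
    intro c d h1 h2 hc hcd hd
    have h3 := (abs_le.1 h2).1
    have h4 : (d * r) * (d * r - c * r) ≤ t * (t - c * r) := by
      have h5 : c * r ≤ d * r := by gcongr
      exact mul_le_mul h1 (by linarith) (by linarith) ht0
    nlinarith [sq_nonneg r]
  rcases hγ with hγ | ⟨hγ, hsT⟩
  · have hg : 2.449 * r ≤ γ := by
      apply le_of_sq_le_sq _ hγ0.le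
      nlinarith [sq_nonneg r]
    have h1 := abs_sub_sq_le_of_mul_le (c := 0.0425) hr (by norm_num) hg hSγ hS0
      (sqrt_sum_coef_le hγ0 hr hb he) ht0
      (abs_sub_mul_sq_le (Real.sqrt_nonneg _) ht0 hτ) (by norm_num)
    have hS1 : S ≤ 0.0306 * r := by
      have : S * (2.449 * r) ≤ S * γ := mul_le_mul_of_nonneg_left hg hS0
      nlinarith
    have h5 := sqrt_sum_le_sqrt_sum_univ (s := s) T
    exact key 0.0425 1.4514 (by linarith) h1 (by norm_num) (by norm_num) (by norm_num)
  · have hg : 1.732 * r ≤ γ := by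
      apply le_of_sq_le_sq _ hγ0.le
      nlinarith [sq_nonneg r]
    have h1 := abs_sub_sq_le_of_mul_le (c := 0.0628) hr (by norm_num) hg hSγ hS0
      (sqrt_sum_coef_le hγ0 hr hb he) ht0
      (abs_sub_mul_sq_le (Real.sqrt_nonneg _) ht0 hτ) (by norm_num)
    have h5 : √(∑ p ∈ T, s p ^ 2) = 0 := by
      rw [Finset.sum_eq_zero fun p hp => by rw [hsT p hp, zero_pow two_ne_zero],
        Real.sqrt_zero]
    exact key 0.0628 1.482 (by linarith) h1 (by norm_num) (by norm_num) (by norm_num)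

end Weights

/-- The correlation of the responses `∑ q, b q * y x q + w` with the `p`-th feature. -/
noncomputable def sampleCoef {X ι : Type*} [Fintype ι] {n : ℕ} (y : X → ι → ℝ) (b : ι → ℝ)
    (x : Fin n → X) (w : Fin n → ℝ) (p : ι) : ℝ :=
  (∑ i, (∑ q, b q * y (x i) q + w i) * y (x i) p) / n

/-- The empirical mean over `q` of the block `T` of the linear form `a` times the whole form. -/
noncomputable def blockWeight {X ι : Type*} [Fintype ι] {m : ℕ} (y : X → ι → ℝ) (T : Finset ι)
    (a : ι → ℝ) (q : Fin m → X) : ℝ :=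
  (∑ r, (∑ p ∈ T, a p * y (q r) p) * ∑ p, a p * y (q r) p) / m

theorem sampleCoef_eq {X ι : Type*} [Fintype ι] {n : ℕ} (y : X → ι → ℝ) (b : ι → ℝ)
    (x : Fin n → X) (w : Fin n → ℝ) (p : ι) :
    sampleCoef y b x w p = b p + (((∑ i, (∑ q, b q * y (x i) q) * y (x i) p) / n - b p) +
      (∑ i, y (x i) p * w i) / n) := by
  simp only [sampleCoef, add_mul, Finset.sum_add_distrib, add_div, mul_comm (w _)]
  ring

theorem signal_error_eq_zero {X ι : Type*} [Fintype ι] [DecidableEq ι] {n : ℕ} (hn : 0 < n)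
    {y : X → ι → ℝ} {b : ι → ℝ} {I T : Finset ι} (hI : I.card = 1)
    (hyI : ∀ x, ∑ p ∈ I, y x p ^ 2 = I.card) (hb : ∀ p, p ∉ I → b p = 0) (hT : T ⊆ I)
    (x : Fin n → X) {p : ι} (hp : p ∈ T) :
    (∑ i, (∑ q, b q * y (x i) q) * y (x i) p) / n - b p = 0 := by
  obtain ⟨p₀, rfl⟩ := Finset.card_eq_one.1 hI
  obtain rfl : p = p₀ := Finset.mem_singleton.1 (hT hp)
  have h1 : ∀ x, (∑ q, b q * y x q) * y x p = b p := by
    intro x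
    rw [Finset.sum_eq_single p (fun q _ hq => by rw [hb q (by simpa using hq), zero_mul])
      (by simp)]
    have h2 := hyI x
    rw [Finset.sum_singleton, Finset.card_singleton, Nat.cast_one] at h2
    rw [mul_assoc, ← sq, h2, mul_one]
  have hn' : (n : ℝ) ≠ 0 := by positivity
  simp only [h1, Finset.sum_const, Finset.card_univ, Fintype.card_fin, nsmul_eq_mul]
  field_simp
  ring

theorem measure_blockWeight_gt_le {X : Type*} [MeasurableSpace X] (μ : Measure X)
    [IsProbabilityMeasure μ] {ι : Type*} [Fintype ι] [DecidableEq ι] {y : X → ι → ℝ}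
    (hm : ∀ p, Measurable fun x => y x p) {M : ℝ} (hy : ∀ x, ∑ p, y x p ^ 2 = M)
    (hort : ∀ p q, ∫ x, y x p * y x q ∂μ = if p = q then 1 else 0) (a : ι → ℝ) (T : Finset ι)
    {κ : ℝ} (hκ : 0 < κ) (hκM : 30 * M * κ ≤ 1) {m : ℕ} (hm0 : 0 < m) :
    (Measure.pi fun _ : Fin m => μ)
      {q | 2.2 * (M * (∑ p ∈ T, a p ^ 2) * ∑ p, a p ^ 2) * κ <
        (blockWeight y T a q - ∑ p ∈ T, a p ^ 2) ^ 2} ≤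
      ENNReal.ofReal (2 * Real.exp (-(m * κ))) := by
  have h := measure_bilinear_mean_sub_sq_gt_le μ hm hy hort (fun p => if p ∈ T then a p else 0) a
    hκ hκM hm0
  simpa [blockWeight, ite_pow, ite_mul, ← sq] using h

theorem two_le_log {M δ : ℝ} (hM : 1 ≤ M) (hδ0 : 0 < δ) (hδ1 : δ < 1) :
    2 ≤ Real.log (12 * M / δ) := by
  rw [Real.le_log_iff_exp_le (by positivity)]
  have h1 : Real.exp 2 ≤ 12 := by
    rw [show (2 : ℝ) = 1 + 1 by norm_num, Real.exp_add]
    nlinarith [Real.exp_one_lt_d9, Real.exp_pos 1]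
  refine h1.trans ?_
  rw [le_div_iff₀ hδ0]
  nlinarith

theorem measurable_blockWeight {X Ω : Type*} [MeasurableSpace X] [MeasurableSpace Ω] {ι : Type*}
    [Fintype ι] {y : X → ι → ℝ} (hm : ∀ p, Measurable fun x => y x p) (T : Finset ι) {m : ℕ}
    {a : Ω → ι → ℝ} (ha : ∀ p, Measurable fun ω => a ω p) {q : Ω → Fin m → X}
    (hq : Measurable q) : Measurable fun ω => blockWeight y T (a ω) (q ω) := by
  have h : ∀ p r, Measurable fun ω => a ω p * y (q ω r) p := fun p r =>
    (ha p).mul ((hm p).comp ((measurable_pi_apply r).comp hq))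
  exact (Finset.measurable_fun_sum _ fun r _ => (Finset.measurable_fun_sum _ fun p _ => h p r).mul
    (Finset.measurable_fun_sum _ fun p _ => h p r)).div_const _

theorem measurable_sampleCoef {X Ω : Type*} [MeasurableSpace X] [MeasurableSpace Ω] {ι : Type*}
    [Fintype ι] {y : X → ι → ℝ} (hm : ∀ p, Measurable fun x => y x p) (b : ι → ℝ) {n : ℕ}
    {x : Ω → Fin n → X} (hx : Measurable x) {w : Ω → Fin n → ℝ} (hw : Measurable w) (p : ι) :
    Measurable fun ω => sampleCoef y b (x ω) (w ω) p := by
  have h : ∀ i, Measurable fun ω => x ω i := fun i => (measurable_pi_apply i).comp hx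
  have h' : ∀ i, Measurable fun ω => w ω i := fun i => (measurable_pi_apply i).comp hw
  exact (Finset.measurable_fun_sum _ fun i _ => ((Finset.measurable_fun_sum _ fun q _ =>
    ((hm q).comp (h i)).const_mul (b q)).add (h' i)).mul ((hm p).comp (h i))).div_const _

set_option maxHeartbeats 1000000 in
theorem le_measure_blockWeight {σ : ℝ} (hσ : 0 < σ) {X : Type*} [MeasurableSpace X]
    (μ : Measure X) [IsProbabilityMeasure μ] {ι : Type*} [Fintype ι] [DecidableEq ι]
    {y : X → ι → ℝ} (hm : ∀ p, Measurable fun x => y x p) {M : ℝ} (hMc : M = Fintype.card ι)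
    (hy : ∀ x, ∑ p, y x p ^ 2 = M)
    (hort : ∀ p q, ∫ x, y x p * y x q ∂μ = if p = q then 1 else 0)
    {I : Finset ι} (hI0 : 0 < I.card) (hyI : ∀ x, ∑ p ∈ I, y x p ^ 2 = I.card)
    {b : ι → ℝ} (hb : ∀ p, p ∉ I → b p = 0) {γ ε δ : ℝ} (hγ0 : 0 < γ) (hε : 0 < ε)
    (hbγ : ∑ p, b p ^ 2 ≤ γ ^ 2) (hγ : 3 * I.card * ε ≤ γ ^ 2)
    {κ : Type*} [Fintype κ] (hκ : Fintype.card κ ≤ Fintype.card ι) (T : κ → Finset ι)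
    (n m : ℕ) (ν : Fin n → Measure ℝ) [∀ i, IsProbabilityMeasure (ν i)]
    (hν : ∀ i l, Integrable (fun s => Real.exp (l * s)) (ν i) ∧
      ∫ s, Real.exp (l * s) ∂(ν i) ≤ Real.exp (l ^ 2 * σ ^ 2 / 2))
    (hδ0 : 0 < δ) (hδ1 : δ < 1)
    (hmm : max (256 * γ ^ 4 / ε ^ 2) 4 * M * Real.log (12 * M / δ) ≤ m)
    (hnn : max (max (400 * γ ^ 4 / ε ^ 2) 4 * M * Real.log (12 * M / δ))
      (16 * M * (σ ^ 2 + 1) / ε) ≤ n) :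
    ENNReal.ofReal (1 - Real.exp (-(1 / (8 * Real.exp 5 * (σ ^ 2 + σ ^ 4)) * M)) - δ) ≤
      ((Measure.pi fun _ : Fin n => μ).prod
        ((Measure.pi ν).prod (Measure.pi fun _ : Fin m => μ)))
        {ω | ∀ ℓ,
          (T ℓ ⊆ I → 3 * ε ≤ ∑ p ∈ T ℓ, b p ^ 2 →
            2 * ε ≤ blockWeight y (T ℓ) (sampleCoef y b ω.1 ω.2.1) ω.2.2) ∧
          ((∀ p ∈ T ℓ, b p = 0) →
            |blockWeight y (T ℓ) (sampleCoef y b ω.1 ω.2.1) ω.2.2| ≤ ε)} := by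
  have hI : I.card ≤ Fintype.card ι := Finset.card_le_univ I
  have hc0 : 0 < Fintype.card ι := hI0.trans_le hI
  have hM1 : 1 ≤ M := by rw [hMc]; exact_mod_cast hc0
  have hM0 : 0 < M := by linarith
  set Λ := Real.log (12 * M / δ) with hΛ
  have hΛ2 : 2 ≤ Λ := two_le_log hM1 hδ0 hδ1
  have hexpΛ : Real.exp (-Λ) = δ / (12 * M) := by
    rw [Real.exp_neg, hΛ, Real.exp_log (by positivity), inv_div]
  have hn1 : max (400 * γ ^ 4 / ε ^ 2) 4 * M * Λ ≤ n := (le_max_left _ _).trans hnn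
  have hn2 : 400 * γ ^ 4 / ε ^ 2 * M * Λ ≤ n := by
    refine le_trans ?_ hn1
    gcongr
    exact le_max_left _ _
  have hn3 : 4 * M * Λ ≤ n := by
    refine le_trans ?_ hn1
    gcongr
    exact le_max_right _ _
  have hn4 : 16 * M * (σ ^ 2 + 1) / ε ≤ n := (le_max_right _ _).trans hnn
  have hm2 : 256 * γ ^ 4 / ε ^ 2 * M * Λ ≤ m := by
    refine le_trans ?_ hmm
    gcongr
    exact le_max_left _ _
  have hn0' : (0 : ℝ) < n := lt_of_lt_of_le (by positivity) hn3
  have hm0' : (0 : ℝ) < m := lt_of_lt_of_le (by positivity) hm2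
  have hn0 : 0 < n := by exact_mod_cast hn0'
  have hm0 : 0 < m := by exact_mod_cast hm0'
  have : Nonempty (Fin n) := ⟨⟨0, hn0⟩⟩
  have hn8 : 8 * M ≤ n := by nlinarith
  have hD1 : (1 : ℝ) ≤ I.card := by exact_mod_cast hI0
  set κS := ε ^ 2 / (400 * γ ^ 4 * M) with hκS
  set κQ := ε ^ 2 / (256 * γ ^ 4 * M) with hκQ
  have hκS0 : 0 < κS := by positivity
  have hκQ0 : 0 < κQ := by positivity
  have hγ4 : 9 * (I.card : ℝ) ^ 2 * ε ^ 2 ≤ γ ^ 4 := by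
    calc 9 * (I.card : ℝ) ^ 2 * ε ^ 2 = (3 * I.card * ε) ^ 2 := by ring
      _ ≤ (γ ^ 2) ^ 2 := pow_le_pow_left₀ (by positivity) hγ 2
      _ = γ ^ 4 := by ring
  have hγ4' : 9 * ((I.card : ℝ) * ε ^ 2) ≤ γ ^ 4 := by
    refine le_trans ?_ hγ4
    rw [mul_assoc]
    gcongr
    nlinarith
  have hγ4'' : 9 * ε ^ 2 ≤ γ ^ 4 := by nlinarith [sq_nonneg ε]
  have hnκ : Λ ≤ n * κS := by
    calc Λ = 400 * γ ^ 4 / ε ^ 2 * M * Λ * κS := by rw [hκS]; field_simp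
      _ ≤ _ := by gcongr
  have hmκ : Λ ≤ m * κQ := by
    calc Λ = 256 * γ ^ 4 / ε ^ 2 * M * Λ * κQ := by rw [hκQ]; field_simp
      _ ≤ _ := by gcongr
  have hB0 : 0 ≤ ∑ p, b p ^ 2 := Finset.sum_nonneg fun p _ => sq_nonneg _
  have hF : ∀ x, (∑ p, b p * y x p) ^ 2 ≤ (∑ p, b p ^ 2) * I.card := by
    intro x
    rw [← hyI x, ← Finset.sum_subset (Finset.subset_univ I) fun p _ hp => by rw [hb p hp, zero_mul],
      ← Finset.sum_subset (Finset.subset_univ I) (f := fun p => b p ^ 2)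
        fun p _ hp => by rw [hb p hp, zero_pow two_ne_zero]]
    exact Finset.sum_mul_sq_le_sq_mul_sq _ _ _
  have hκF : 30 * ((∑ p, b p ^ 2) * I.card) * Fintype.card ι * κS ≤ 0.01 * ∑ p, b p ^ 2 := by
    rw [← hMc]
    calc 30 * ((∑ p, b p ^ 2) * I.card) * M * κS
        = (∑ p, b p ^ 2) * (30 * (I.card * ε ^ 2) / (400 * γ ^ 4)) := by
          rw [hκS]; field_simp
      _ ≤ (∑ p, b p ^ 2) * 0.01 := by
          refine mul_le_mul_of_nonneg_left ?_ hB0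
          rw [div_le_iff₀ (by positivity)]
          linarith [pow_pos hγ0 4]
      _ = _ := mul_comm _ _
  have hκQM : 30 * M * κQ ≤ 1 := by
    have : 30 * M * κQ = 30 * ε ^ 2 / (256 * γ ^ 4) := by rw [hκQ]; field_simp
    rw [this, div_le_one (by positivity)]
    linarith [pow_pos hγ0 4]
  subst hMc
  obtain ⟨k, hk0, hk⟩ := measure_trace_gramSum_pow_gt_le μ hm hc0 hy hort n hn8
  set M : ℝ := (Fintype.card ι : ℝ) with hMdef
  have hS := measure_signal_mean_sub_sq_gt_le μ hm hy hort b hF hκS0 hκF hn0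
  set B₁ : Set (Fin n → X) := {x | (Real.exp 5 * n) ^ k ≤ (gramSum (fun i => y (x i)) ^ k).trace} ∪
    {x | 2.222 * (M * ∑ p, b p ^ 2) * κS <
        ∑ p, ((∑ i, (∑ q, b q * y (x i) q) * y (x i) p) / n - b p) ^ 2} with hB₁
  set B₂ : Set ((Fin n → X) × (Fin n → ℝ)) :=
    {z | (σ ^ 2 + 1) * M * n ≤ ∑ p, (∑ i, y (z.1 i) p * z.2 i) ^ 2} with hB₂
  set B₃ : Set ((Fin n → X) × (Fin n → ℝ) × (Fin m → X)) := ⋃ ℓ,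
    {ω | 2.2 * (M * (∑ p ∈ T ℓ, sampleCoef y b ω.1 ω.2.1 p ^ 2) *
        ∑ p, sampleCoef y b ω.1 ω.2.1 p ^ 2) * κQ <
      (blockWeight y (T ℓ) (sampleCoef y b ω.1 ω.2.1) ω.2.2 -
        ∑ p ∈ T ℓ, sampleCoef y b ω.1 ω.2.1 p ^ 2) ^ 2} with hB₃
  have hsum : M * Real.exp (-(2 * (n / M))) + M * (2 * Real.exp (-(n * κS))) +
      Real.exp (-(1 / (8 * Real.exp 5 * (σ ^ 2 + σ ^ 4)) * M)) + M * (2 * Real.exp (-(m * κQ))) ≤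
      Real.exp (-(1 / (8 * Real.exp 5 * (σ ^ 2 + σ ^ 4)) * M)) + δ := by
    have h1 : Real.exp (-(2 * (n / M))) ≤ δ / (12 * M) := by
      rw [← hexpΛ]
      have : 4 * Λ ≤ n / M := by rw [le_div_iff₀ hM0]; linarith
      exact Real.exp_le_exp.2 (by linarith)
    have h2 : Real.exp (-(n * κS)) ≤ δ / (12 * M) := by
      rw [← hexpΛ]; exact Real.exp_le_exp.2 (by linarith)
    have h3 : Real.exp (-(m * κQ)) ≤ δ / (12 * M) := by
      rw [← hexpΛ]; exact Real.exp_le_exp.2 (by linarith)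
    have h4 : M * (δ / (12 * M)) = δ / 12 := by field_simp
    have h5 := mul_le_mul_of_nonneg_left h1 hM0.le
    have h6 := mul_le_mul_of_nonneg_left h2 hM0.le
    have h7 := mul_le_mul_of_nonneg_left h3 hM0.le
    rw [h4] at h5 h6 h7
    linarith
  have hsc : ∀ p, Measurable fun ω : (Fin n → X) × (Fin n → ℝ) × (Fin m → X) =>
      sampleCoef y b ω.1 ω.2.1 p :=
    measurable_sampleCoef hm b measurable_fst (measurable_fst.comp measurable_snd)
  have hc₁ : 0 ≤ M * Real.exp (-(2 * (n / M))) + M * (2 * Real.exp (-(n * κS))) :=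
    add_nonneg (mul_nonneg hM0.le (Real.exp_pos _).le)
      (mul_nonneg hM0.le (mul_nonneg zero_le_two (Real.exp_pos _).le))
  have hc₂ := (Real.exp_pos (-(1 / (8 * Real.exp 5 * (σ ^ 2 + σ ^ 4)) * M))).le
  have hc₃ : 0 ≤ M * (2 * Real.exp (-(m * κQ))) :=
    mul_nonneg hM0.le (mul_nonneg zero_le_two (Real.exp_pos _).le)
  have hle : 1 - Real.exp (-(1 / (8 * Real.exp 5 * (σ ^ 2 + σ ^ 4)) * M)) - δ ≤
      1 - (M * Real.exp (-(2 * (n / M))) + M * (2 * Real.exp (-(n * κS))) +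
        Real.exp (-(1 / (8 * Real.exp 5 * (σ ^ 2 + σ ^ 4)) * M)) +
        M * (2 * Real.exp (-(m * κQ)))) := by
    linarith
  refine (ENNReal.ofReal_le_ofReal hle).trans ?_
  refine le_measure_prod_prod (B₁ := B₁) (B₂ := B₂) (B₃ := B₃) _ _ _ ?_ ?_ ?_ hc₁ hc₂ hc₃
    ?_ ?_ ?_ ?_
  · have hmeas : ∀ p q, Measurable fun x : Fin n → X => gramSum (fun i => y (x i)) p q := by
      intro p q
      simp only [gramSum_apply]
      exact Finset.measurable_fun_sum _ fun i _ =>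
        ((hm p).comp (measurable_pi_apply i)).mul ((hm q).comp (measurable_pi_apply i))
    have hpow := (exists_bound_and_measurable_pow hmeas (B := n * M) (fun x p q => by
      have := abs_gramSum_add_le (ι := ι) hM0.le le_rfl (fun i : Fin n => hy (x i)) p q
      simpa using this) k).1
    refine MeasurableSet.union (measurableSet_le measurable_const ?_)
      (measurableSet_lt measurable_const ?_)
    · simp only [Matrix.trace, diag_apply]
      exact Finset.measurable_fun_sum _ fun p _ => hpow p p
    · refine Finset.measurable_fun_sum _ fun p _ => (((Finset.measurable_fun_sum _ fun i _ =>
        (((measurable_sum_mul hm b).comp (measurable_pi_apply i)).mul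
          ((hm p).comp (measurable_pi_apply i)))).div_const _).sub_const _).pow_const 2
  · have h : ∀ p, Measurable fun z : (Fin n → X) × (Fin n → ℝ) =>
        ∑ i, y (z.1 i) p * z.2 i := by
      intro p
      refine Finset.measurable_fun_sum _ fun i _ => Measurable.mul ?_ ?_
      · exact (hm p).comp (g := fun x => y x p) ((measurable_pi_apply i).comp measurable_fst)
      · exact (measurable_pi_apply i).comp measurable_snd
    exact measurableSet_le measurable_const
      (Finset.measurable_fun_sum _ fun p _ => (h p).pow_const 2)
  · have h : ∀ S : Finset ι, Measurable fun ω : (Fin n → X) × (Fin n → ℝ) × (Fin m → X) =>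
        ∑ p ∈ S, sampleCoef y b ω.1 ω.2.1 p ^ 2 :=
      fun S => Finset.measurable_fun_sum _ fun p _ => (hsc p).pow_const 2
    have h' : ∀ ℓ, Measurable fun ω : (Fin n → X) × (Fin n → ℝ) × (Fin m → X) =>
        blockWeight y (T ℓ) (sampleCoef y b ω.1 ω.2.1) ω.2.2 :=
      fun ℓ => measurable_blockWeight hm (T ℓ) hsc (measurable_snd.comp measurable_snd)
    exact MeasurableSet.iUnion fun ℓ => measurableSet_lt
      (((((h (T ℓ)).const_mul M).mul (h Finset.univ)).const_mul 2.2).mul_const κQ)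
      (((h' ℓ).sub (h (T ℓ))).pow_const 2)
  · rw [ENNReal.ofReal_add (by positivity) (by positivity)]
    exact (measure_union_le _ _).trans (add_le_add hk hS)
  · intro x hx
    simp only [hB₁, Set.mem_union, not_or, Set.mem_ofPred_eq, not_le] at hx
    have := measure_noise_ge_le ν hσ hν (fun i => y (x i)) M (fun i => hy (x i))
      (Real.exp_pos 5) hk0 (by simpa using hx.1.le)
    simpa [hB₂] using this
  · intro x w
    have hset : {q | (x, w, q) ∈ B₃} = ⋃ ℓ, {q : Fin m → X |
        2.2 * (M * (∑ p ∈ T ℓ, sampleCoef y b x w p ^ 2) * ∑ p, sampleCoef y b x w p ^ 2) * κQ <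
        (blockWeight y (T ℓ) (sampleCoef y b x w) q - ∑ p ∈ T ℓ, sampleCoef y b x w p ^ 2) ^ 2} := by
      ext q
      simp [hB₃]
    rw [hset]
    refine (measure_iUnion_fintype_le _ _).trans ((Finset.sum_le_sum fun ℓ _ =>
      measure_blockWeight_gt_le μ hm hy hort (sampleCoef y b x w) (T ℓ) hκQ0 hκQM hm0).trans ?_)
    rw [Finset.sum_const, Finset.card_univ, nsmul_eq_mul, ENNReal.ofReal_mul hM0.le, hMdef,
      ENNReal.ofReal_natCast]
    gcongr
  · intro x w q hx hw hq ℓ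
    simp only [hB₁, hB₂, hB₃, Set.mem_union, not_or, Set.mem_ofPred_eq, not_le, not_lt,
      Set.mem_iUnion, not_exists] at hx hw hq
    have hs := hx.2
    have hτ := hq ℓ
    set s : ι → ℝ := fun p => (∑ i, (∑ q, b q * y (x i) q) * y (x i) p) / n - b p with hs_def
    set e : ι → ℝ := fun p => (∑ i, y (x i) p * w i) / n with he_def
    have hfun : sampleCoef y b x w = fun p => b p + (s p + e p) :=
      funext fun p => sampleCoef_eq y b x w p
    set r := √ε with hr
    have hr0 : 0 < r := Real.sqrt_pos.2 hε
    have hr2 : r ^ 2 = ε := Real.sq_sqrt hε.le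
    have hr4 : r ^ 4 = ε ^ 2 := by rw [← hr2]; ring
    have hs' : (∑ p, s p ^ 2) * γ ^ 2 ≤ 2.222 / 400 * r ^ 4 := by
      have h1 : ∑ p, s p ^ 2 ≤ 2.222 * (M * γ ^ 2) * κS := hs.trans (by gcongr)
      calc (∑ p, s p ^ 2) * γ ^ 2 ≤ 2.222 * (M * γ ^ 2) * κS * γ ^ 2 := by gcongr
        _ = _ := by rw [hr4, hκS]; field_simp
    have he' : ∑ p, e p ^ 2 ≤ r ^ 2 / 16 := by
      simp only [he_def, div_pow]
      rw [← Finset.sum_div, div_le_iff₀ (by positivity), hr2]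
      refine hw.le.trans ?_
      rw [div_le_iff₀ hε] at hn4
      linarith [mul_le_mul_of_nonneg_right hn4 hn0'.le]
    have hτ' : (blockWeight y (T ℓ) (sampleCoef y b x w) q -
        ∑ p ∈ T ℓ, (b p + (s p + e p)) ^ 2) ^ 2 * γ ^ 4 ≤ 2.2 / 256 * r ^ 4 *
        ((∑ p ∈ T ℓ, (b p + (s p + e p)) ^ 2) * ∑ p, (b p + (s p + e p)) ^ 2) := by
      have h1 : ∀ p, sampleCoef y b x w p = b p + (s p + e p) := congrFun hfun
      simp only [h1] at hτ
      generalize ∑ p ∈ T ℓ, (b p + (s p + e p)) ^ 2 = A at hτ ⊢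
      generalize ∑ p, (b p + (s p + e p)) ^ 2 = A' at hτ ⊢
      refine (mul_le_mul_of_nonneg_right hτ (by positivity)).trans (le_of_eq ?_)
      rw [hr4, hκQ]
      field_simp
    have h3 : 3 * r ^ 2 ≤ γ ^ 2 := by
      rw [hr2]
      linarith [mul_le_mul_of_nonneg_right hD1 hε.le]
    refine ⟨fun hTI hTb => ?_, fun hT0 => ?_⟩
    · rw [← hr2]
      refine two_mul_le_weight_of_informative hγ0 hr0 ?_ hbγ hs' he' (by rw [hr2]; exact hTb) hτ'
      rcases (Nat.succ_le_iff.2 hI0).eq_or_lt with h | h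
      · exact Or.inr ⟨h3, fun p hp => signal_error_eq_zero hn0 h.symm hyI hb hTI x hp⟩
      · left
        have : (2 : ℝ) ≤ I.card := by exact_mod_cast h
        rw [hr2]
        linarith [mul_le_mul_of_nonneg_right this hε.le]
    · have := abs_weight_le_of_redundant hγ0 hr0 h3 hbγ hs' he' hT0 hτ'
      rwa [hr2] at this

section Channels

variable {K : ℕ} {N : Fin K → ℕ}

theorem sum_filter_fst_eq (f : ((ℓ : Fin K) × Fin (N ℓ)) → ℝ) (ℓ : Fin K) :
    ∑ p ∈ Finset.univ.filter (fun p : (ℓ : Fin K) × Fin (N ℓ) => p.1 = ℓ), f p =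
      ∑ j, f ⟨ℓ, j⟩ := by
  rw [Finset.sum_filter, Fintype.sum_sigma, Finset.sum_eq_single ℓ]
  · simp
  · intro k _ hk
    simp [hk]
  · simp

theorem sum_filter_fst_le (f : ((ℓ : Fin K) × Fin (N ℓ)) → ℝ) (ℓ₀ : ℕ) :
    ∑ p ∈ Finset.univ.filter (fun p : (ℓ : Fin K) × Fin (N ℓ) => (p.1 : ℕ) ≤ ℓ₀), f p =
      ∑ ℓ : Fin K, if (ℓ : ℕ) ≤ ℓ₀ then ∑ j, f ⟨ℓ, j⟩ else 0 := by
  rw [Finset.sum_filter, Fintype.sum_sigma]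
  refine Finset.sum_congr rfl fun ℓ _ => ?_
  split_ifs <;> simp

theorem attention_weight_eq_blockWeight {X : Type*} (Y : ((ℓ : Fin K) × Fin (N ℓ)) → X → ℝ)
    (b : ((ℓ : Fin K) × Fin (N ℓ)) → ℝ) {n m : ℕ} (x : Fin n → X) (w : Fin n → ℝ)
    (q : Fin m → X) {y : Fin n → ℝ} (hy : ∀ i, y i = ∑ p, b p * Y p (x i) + w i) (ℓ : Fin K) :
    (1 / ((n : ℝ) ^ 2 * m)) *
      (y ⬝ᵥ (Matrix.of fun (i : Fin n) (j : Fin (N ℓ)) => Y ⟨ℓ, j⟩ (x i)).mulVec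
        ((Matrix.of fun (r : Fin m) (j : Fin (N ℓ)) => Y ⟨ℓ, j⟩ (q r))ᵀ.mulVec
          ((Matrix.of fun (r : Fin m) (p : (ℓ' : Fin K) × Fin (N ℓ')) => Y p (q r)).mulVec
            ((Matrix.of fun (i : Fin n) (p : (ℓ' : Fin K) × Fin (N ℓ')) =>
              Y p (x i))ᵀ.mulVec y)))) =
      blockWeight (fun x p => Y p x)
        (Finset.univ.filter fun p : (ℓ : Fin K) × Fin (N ℓ) => p.1 = ℓ)
        (sampleCoef (fun x p => Y p x) b x w) q := by
  have hv : (Matrix.of fun (i : Fin n) (p : (ℓ' : Fin K) × Fin (N ℓ')) => Y p (x i))ᵀ.mulVec y =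
      fun p => ∑ i, y i * Y p (x i) := by
    ext p
    simp [Matrix.mulVec, dotProduct, mul_comm]
  have hu : y ᵥ* (Matrix.of fun (i : Fin n) (j : Fin (N ℓ)) => Y ⟨ℓ, j⟩ (x i)) =
      fun j => ∑ i, y i * Y ⟨ℓ, j⟩ (x i) := by
    ext j
    simp [Matrix.vecMul, dotProduct]
  rw [hv, Matrix.dotProduct_mulVec, hu, Matrix.dotProduct_mulVec, Matrix.vecMul_transpose,
    dotProduct, blockWeight]
  simp only [sum_filter_fst_eq, sampleCoef, ← hy, Matrix.mulVec, dotProduct, Matrix.of_apply,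
    div_mul_eq_mul_div, mul_div_assoc', one_mul, ← Finset.sum_div, div_div]
  congr 1
  · simp only [mul_comm]
  · ring

theorem sum_sq_of_informative {ℓ : Fin K} {β : Fin (N ℓ) → ℝ} {β₀ : ℝ} (hN : 1 ≤ N ℓ)
    (hβ₀ : 0 < β₀) (hβ : ∀ j, β₀ * (Real.sqrt (N ℓ))⁻¹ ≤ |β j|) : β₀ ^ 2 ≤ ∑ j, β j ^ 2 := by
  have hN0 : (0 : ℝ) < N ℓ := by exact_mod_cast hN
  have h : ∀ j, β₀ ^ 2 / N ℓ ≤ β j ^ 2 := by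
    intro j
    have h1 := pow_le_pow_left₀ (by positivity) (hβ j) 2
    rwa [mul_pow, inv_pow, Real.sq_sqrt hN0.le, sq_abs, ← div_eq_mul_inv] at h1
  calc β₀ ^ 2 = ∑ _j : Fin (N ℓ), β₀ ^ 2 / N ℓ := by
        rw [Finset.sum_const, Finset.card_univ, Fintype.card_fin, nsmul_eq_mul]
        field_simp
    _ ≤ _ := Finset.sum_le_sum fun j _ => h j

end Channels

/-- Learnable channel selection (Theorem 1 of the paper, abstract form).  With an orthonormal
system `Y_{ℓ,j}` (`0 ≤ ℓ ≤ L`, `1 ≤ j ≤ N_ℓ`, `M = Σ N_ℓ`) in `L²(μ)` satisfying the addition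
formula, a target `f* = Σ_{ℓ≤ℓ₀} Σ_j β_{ℓ,j} Y_{ℓ,j}` whose coefficients satisfy
`Σ N_ℓ β_{ℓ,j}² ≤ γ₀²` and `|β_{ℓ,j}| ≥ β₀ N_ℓ^{−1/2}`, i.i.d. training inputs `x₁,…,xₙ ∼ μ`,
independent mean-zero `σ₀²`-sub-Gaussian noises `w₁,…,wₙ`, responses `y_i = f*(x_i) + w_i`, and
independent i.i.d. weights `q₁,…,q_m ∼ μ`, define the one-step-GD channel attention weights
`τ_ℓ := (1/(n²m)) yᵀ Y(S,ℓ) Y(Q,ℓ)ᵀ Y(Q) Y(S)ᵀ y`.  If `ε₀ ∈ (0, β₀²/3]` and `m`, `n` are large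
enough, then there is `c > 0` depending only on `σ₀` such that for every `δ ∈ (0,1)`, with
probability at least `1 − exp(−cM) − δ` : `τ_ℓ ≥ 2ε₀` for all informative channels `ℓ ≤ ℓ₀` and
`|τ_ℓ| ≤ ε₀` for all redundant channels `ℓ₀ < ℓ ≤ L`. -/
theorem learnable_channel_selection (σ₀ : ℝ) (hσ₀ : 0 < σ₀) :
    ∃ c > (0 : ℝ),
      ∀ (X : Type) (_ : MeasurableSpace X) (μ : Measure X), IsProbabilityMeasure μ →
      ∀ (L ℓ₀ : ℕ), ℓ₀ ≤ L →
      ∀ N : Fin (L + 1) → ℕ, (∀ ℓ, 1 ≤ N ℓ) →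
      ∀ M : ℕ, M = ∑ ℓ : Fin (L + 1), N ℓ →
      ∀ Y : ((ℓ : Fin (L + 1)) × Fin (N ℓ)) → X → ℝ,
        (∀ p, Measurable (Y p)) →
        (∀ p q, ∫ x, Y p x * Y q x ∂μ = if p = q then 1 else 0) →
        (∀ (ℓ : Fin (L + 1)) (x : X), ∑ j : Fin (N ℓ), Y ⟨ℓ, j⟩ x ^ 2 = N ℓ) →
      ∀ (β : (ℓ : Fin (L + 1)) → Fin (N ℓ) → ℝ) (γ₀ β₀ : ℝ), 0 < γ₀ → 0 < β₀ →
        (∑ ℓ : Fin (L + 1),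
            if (ℓ : ℕ) ≤ ℓ₀ then ∑ j : Fin (N ℓ), (N ℓ : ℝ) * β ℓ j ^ 2 else 0) ≤ γ₀ ^ 2 →
        (∀ ℓ : Fin (L + 1), (ℓ : ℕ) ≤ ℓ₀ →
          ∀ j : Fin (N ℓ), β₀ * (Real.sqrt (N ℓ))⁻¹ ≤ |β ℓ j|) →
      ∀ (n m : ℕ) (ν : Fin n → Measure ℝ), (∀ i, IsProbabilityMeasure (ν i)) →
        (∀ (i : Fin n) (l : ℝ),
          Integrable (fun s => Real.exp (l * s)) (ν i) ∧
            ∫ s, Real.exp (l * s) ∂(ν i) ≤ Real.exp (l ^ 2 * σ₀ ^ 2 / 2)) →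
      ∀ δ ε₀ : ℝ, 0 < δ → δ < 1 → 0 < ε₀ → ε₀ ≤ β₀ ^ 2 / 3 →
        max (256 * γ₀ ^ 4 / ε₀ ^ 2) 4 * M * Real.log (12 * M / δ) ≤ (m : ℝ) →
        max (max (400 * γ₀ ^ 4 / ε₀ ^ 2) 4 * M * Real.log (12 * M / δ))
            (16 * M * (σ₀ ^ 2 + 1) / ε₀) ≤ (n : ℝ) →
        ((Measure.pi fun _ : Fin n => μ).prod
              ((Measure.pi ν).prod (Measure.pi fun _ : Fin m => μ)))
            {ω : (Fin n → X) × (Fin n → ℝ) × (Fin m → X) |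
              ∀ ℓ : Fin (L + 1),
                let xs := ω.1
                let ws := ω.2.1
                let qs := ω.2.2
                let y : Fin n → ℝ := fun i =>
                  (∑ ℓ' : Fin (L + 1),
                      if (ℓ' : ℕ) ≤ ℓ₀ then
                        ∑ j : Fin (N ℓ'), β ℓ' j * Y ⟨ℓ', j⟩ (xs i)
                      else 0) + ws i
                let τ : ℝ :=
                  (1 / ((n : ℝ) ^ 2 * m)) *
                    (y ⬝ᵥ
                      (Matrix.of fun (i : Fin n) (j : Fin (N ℓ)) => Y ⟨ℓ, j⟩ (xs i)).mulVec
                        ((Matrix.of fun (r : Fin m) (j : Fin (N ℓ)) => Y ⟨ℓ, j⟩ (qs r))ᵀ.mulVec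
                          ((Matrix.of fun (r : Fin m) (p : (ℓ' : Fin (L + 1)) × Fin (N ℓ')) =>
                                Y p (qs r)).mulVec
                            ((Matrix.of fun (i : Fin n) (p : (ℓ' : Fin (L + 1)) × Fin (N ℓ')) =>
                                  Y p (xs i))ᵀ.mulVec y))))
                ((ℓ : ℕ) ≤ ℓ₀ → 2 * ε₀ ≤ τ) ∧ (ℓ₀ < (ℓ : ℕ) → |τ| ≤ ε₀)} ≥
          ENNReal.ofReal (1 - Real.exp (-(c * M)) - δ) := by
  refine ⟨1 / (8 * Real.exp 5 * (σ₀ ^ 2 + σ₀ ^ 4)), by positivity, ?_⟩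
  intro X _ μ _ L ℓ₀ hℓ₀ N hN M hM Y hYm hort hY β γ₀ β₀ hγ₀ hβ₀ hβγ hβ n m ν _ hν δ ε₀ hδ0 hδ1
    hε₀ hεβ hm hn
  set b : ((ℓ : Fin (L + 1)) × Fin (N ℓ)) → ℝ :=
    fun p => if (p.1 : ℕ) ≤ ℓ₀ then β p.1 p.2 else 0 with hb
  set I : Finset ((ℓ : Fin (L + 1)) × Fin (N ℓ)) :=
    Finset.univ.filter fun p => (p.1 : ℕ) ≤ ℓ₀ with hI
  set T : Fin (L + 1) → Finset ((ℓ : Fin (L + 1)) × Fin (N ℓ)) :=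
    fun ℓ => Finset.univ.filter fun p => p.1 = ℓ with hT
  have hcard : M = Fintype.card ((ℓ : Fin (L + 1)) × Fin (N ℓ)) := by
    simp [hM, Fintype.card_sigma]
  have hIcard : (I.card : ℝ) = ∑ ℓ : Fin (L + 1), if (ℓ : ℕ) ≤ ℓ₀ then (N ℓ : ℝ) else 0 := by
    have h := sum_filter_fst_le (N := N) (fun _ => 1) ℓ₀
    simpa using h
  have hbsum : ∀ ℓ : Fin (L + 1), (ℓ : ℕ) ≤ ℓ₀ → β₀ ^ 2 ≤ ∑ j, β ℓ j ^ 2 := fun ℓ hℓ =>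
    sum_sq_of_informative (hN ℓ) hβ₀ (hβ ℓ hℓ)
  have hmono : ∑ p, b p ^ 2 ≤ γ₀ ^ 2 := by
    refine le_trans ?_ hβγ
    rw [Fintype.sum_sigma]
    refine Finset.sum_le_sum fun ℓ _ => ?_
    by_cases hℓ : (ℓ : ℕ) ≤ ℓ₀
    · simp only [hb, hℓ, if_true]
      have : (1 : ℝ) ≤ N ℓ := by exact_mod_cast hN ℓ
      exact Finset.sum_le_sum fun j _ => le_mul_of_one_le_left (sq_nonneg _) this
    · simp [hb, hℓ]
  have hdim : 3 * I.card * ε₀ ≤ γ₀ ^ 2 := by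
    refine le_trans ?_ hβγ
    rw [hIcard, Finset.mul_sum, Finset.sum_mul]
    refine Finset.sum_le_sum fun ℓ _ => ?_
    by_cases hℓ : (ℓ : ℕ) ≤ ℓ₀
    · simp only [hℓ, if_true]
      rw [← Finset.mul_sum]
      have h1 : 3 * ε₀ ≤ ∑ j, β ℓ j ^ 2 := le_trans (by linarith) (hbsum ℓ hℓ)
      linarith [mul_le_mul_of_nonneg_left h1 (Nat.cast_nonneg (α := ℝ) (N ℓ))]
    · simp [hℓ]
  have hκ : Fintype.card (Fin (L + 1)) ≤ Fintype.card ((ℓ : Fin (L + 1)) × Fin (N ℓ)) :=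
    Fintype.card_le_of_injective (fun ℓ => ⟨ℓ, ⟨0, hN ℓ⟩⟩) fun ℓ ℓ' h => congrArg Sigma.fst h
  have h := le_measure_blockWeight hσ₀ μ (y := fun x p => Y p x) (M := M) hYm
    (by exact_mod_cast hcard)
    (fun x => by simp [Fintype.sum_sigma, hY, hM]) hort (I := I)
    (Finset.card_pos.2 ⟨⟨0, ⟨0, hN 0⟩⟩, by simp [hI]⟩)
    (fun x => by rw [hIcard, hI, sum_filter_fst_le]; simp [hY]) (b := b)
    (fun p hp => by
      have : ¬ (p.1 : ℕ) ≤ ℓ₀ := by simpa [hI] using hp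
      simp [hb, this]) hγ₀ hε₀ hmono hdim hκ T n m ν hν hδ0 hδ1 hm hn
  refine h.trans (measure_mono fun ω hω ℓ => ?_)
  intro xs ws qs y τ
  have hy : ∀ i, y i = ∑ p, b p * Y p (xs i) + ws i := by
    intro i
    simp only [y, hb, Fintype.sum_sigma, add_left_inj]
    refine Finset.sum_congr rfl fun ℓ' _ => ?_
    split_ifs <;> simp
  have hτ : τ = blockWeight (fun x p => Y p x) (T ℓ) (sampleCoef (fun x p => Y p x) b xs ws) qs :=
    attention_weight_eq_blockWeight Y b xs ws qs hy ℓ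
  rw [hτ]
  refine ⟨fun hℓ => (hω ℓ).1 (fun p hp => ?_) ?_, fun hℓ => (hω ℓ).2 fun p hp => ?_⟩
  · simp only [hT, Finset.mem_filter, Finset.mem_univ, true_and] at hp
    simpa [hI, hp] using hℓ
  · rw [hT, sum_filter_fst_eq]
    simp only [hb, hℓ, if_true]
    linarith [hbsum ℓ hℓ]
  · simp only [hT, Finset.mem_filter, Finset.mem_univ, true_and] at hp
    simp [hb, hp, hℓ]
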